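/- Let w be any one of the four Chebyshev weights and let u(x)=(1−x)^γ(1+x)^δ be a Jacobi weight whose exponents satisfy conditions (hp-u) relative to w. Then for every constant c1>1 there exists C>0, independent of n, m and f, such that for all integers n,m with 0<m<n≤c1·m and every f∈C^0_u one has E_{n+m−1}(f)_u ≤ ‖(V_n^m f − f)·u‖ ≤ C·E_{n−m}(f)_u. -/

import Mathlib

open Real Set Finset Polynomial

noncomputable section

/-- The four kinds of Chebyshev weights. -/
inductive ChebKind | one | two | three | four

/-- The Chebyshev weight function of each kind. -/
noncomputable def wFn : ChebKind → ℝ → ℝ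
  | .one,   x => 1 / Real.sqrt (1 - x ^ 2)
  | .two,   x => Real.sqrt (1 - x ^ 2)
  | .three, x => Real.sqrt ((1 + x) / (1 - x))
  | .four,  x => Real.sqrt ((1 - x) / (1 + x))

/-- The orthonormal polynomials associated with each Chebyshev weight
(`p_j(w,·)`), expressed via Mathlib's Chebyshev polynomials of the first and
second kind.  On `[-1,1]` these coincide with the usual trigonometric forms. -/
noncomputable def pPoly : ChebKind → ℕ → Polynomial ℝ
  | .one, 0       => Polynomial.C (1 / Real.sqrt π)
  | .one, (j + 1) => Polynomial.C (Real.sqrt (2 / π)) * Polynomial.Chebyshev.T ℝ ((j : ℤ) + 1)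
  | .two, j       => Polynomial.C (Real.sqrt (2 / π)) * Polynomial.Chebyshev.U ℝ (j : ℤ)
  | .three, j     => Polynomial.C (1 / Real.sqrt π) *
      (Polynomial.Chebyshev.U ℝ (j : ℤ) - Polynomial.Chebyshev.U ℝ ((j : ℤ) - 1))
  | .four, j      => Polynomial.C (1 / Real.sqrt π) *
      (Polynomial.Chebyshev.U ℝ (j : ℤ) + Polynomial.Chebyshev.U ℝ ((j : ℤ) - 1))

noncomputable def pEval (w : ChebKind) (j : ℕ) (x : ℝ) : ℝ := (pPoly w j).eval x

/-- Angular Chebyshev nodes `t_k^n`. -/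
noncomputable def tNode : ChebKind → ℕ → ℕ → ℝ
  | .one,   n, k => (2 * (k : ℝ) - 1) * π / (2 * n)
  | .two,   n, k => (k : ℝ) * π / (n + 1)
  | .three, n, k => (2 * (k : ℝ) - 1) * π / (2 * n + 1)
  | .four,  n, k => 2 * (k : ℝ) * π / (2 * n + 1)

/-- Chebyshev nodes `x_k^n = cos t_k^n`, zeros of `p_n(w,·)`. -/
noncomputable def xNode (w : ChebKind) (n k : ℕ) : ℝ := Real.cos (tNode w n k)

/-- Christoffel numbers `λ_k^n`. -/
noncomputable def lam : ChebKind → ℕ → ℕ → ℝ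
  | .one,   n, _ => π / n
  | .two,   n, k => π / (n + 1) * Real.sin (tNode .two n k) ^ 2
  | .three, n, k => 4 * π / (2 * n + 1) * Real.cos (tNode .three n k / 2) ^ 2
  | .four,  n, k => 4 * π / (2 * n + 1) * Real.sin (tNode .four n k / 2) ^ 2

/-- de la Vallée Poussin filter coefficients `μ_{n,j}^m`. -/
noncomputable def mufilt (n m j : ℕ) : ℝ :=
  if j ≤ n - m then 1 else ((n : ℝ) + m - j) / (2 * m)

/-- Fundamental VP polynomials `Φ_{n,k}^m(w;x)`. -/
noncomputable def Phi (w : ChebKind) (n m k : ℕ) (x : ℝ) : ℝ :=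
  lam w n k * ∑ j ∈ Finset.range (n + m), mufilt n m j * pEval w j (xNode w n k) * pEval w j x

/-- The VP interpolation polynomial `V_n^m f`. -/
noncomputable def VP (w : ChebKind) (n m : ℕ) (f : ℝ → ℝ) (x : ℝ) : ℝ :=
  ∑ k ∈ Finset.Icc 1 n, f (xNode w n k) * Phi w n m k x

/-- Jacobi weight `u(x) = (1-x)^γ (1+x)^δ`. -/
noncomputable def jac (γ δ : ℝ) (x : ℝ) : ℝ := (1 - x) ^ γ * (1 + x) ^ δ

/-- Weighted uniform norm `‖f·u‖ = max_{|x|≤1} |f(x) u(x)|`. -/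
noncomputable def wnorm (γ δ : ℝ) (f : ℝ → ℝ) : ℝ :=
  sSup ((fun x => |f x * jac γ δ x|) '' Set.Icc (-1 : ℝ) 1)

/-- Error of best weighted polynomial approximation `E_n(f)_u`. -/
noncomputable def bestE (γ δ : ℝ) (n : ℕ) (f : ℝ → ℝ) : ℝ :=
  sInf ((fun P : Polynomial ℝ => wnorm γ δ (fun x => f x - P.eval x)) ''
    {P : Polynomial ℝ | P.natDegree ≤ n})

/-- Membership in the space `C^0_u`: `f` is continuous on compact subsets of
`(-1,1)`, `f·u` extends continuously to `[-1,1]`, with value (= limit) `0` at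
`±1` when the corresponding exponent is positive. -/
def MemC0 (γ δ : ℝ) (f : ℝ → ℝ) : Prop :=
  ContinuousOn f (Set.Ioo (-1 : ℝ) 1) ∧
  ContinuousOn (fun x => f x * jac γ δ x) (Set.Icc (-1 : ℝ) 1) ∧
  (0 < γ → f 1 * jac γ δ 1 = 0) ∧ (0 < δ → f (-1) * jac γ δ (-1) = 0)

/-- Conditions (hp-u) on the exponents of `u=(1-x)^γ(1+x)^δ` relative to `w`. -/
def hpu : ChebKind → ℝ → ℝ → Prop
  | .one,   γ, δ => 0 ≤ γ ∧ γ ≤ 1 ∧ 0 ≤ δ ∧ δ ≤ 1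
  | .two,   γ, δ => 0 < γ ∧ γ ≤ 3 / 2 ∧ 0 < δ ∧ δ ≤ 3 / 2 ∧ -1 ≤ γ - δ ∧ γ - δ ≤ 1
  | .three, γ, δ => 0 ≤ γ ∧ γ ≤ 1 ∧ 0 < δ ∧ δ ≤ 3 / 2 ∧ γ - δ ≤ 1 / 2
  | .four,  γ, δ => 0 < γ ∧ γ ≤ 3 / 2 ∧ 0 ≤ δ ∧ δ ≤ 1 ∧ -(1 / 2) ≤ γ - δ

/-- `φ(x) = sqrt(1-x²)`. -/
noncomputable def phi (x : ℝ) : ℝ := Real.sqrt (1 - x ^ 2)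

/-- The set of values `|f^{(r)}(x)| φ(x)^r u(x)`, `x ∈ (-1,1)`. -/
noncomputable def derSet (γ δ : ℝ) (r : ℕ) (f : ℝ → ℝ) : Set ℝ :=
  (fun x : ℝ => |iteratedDerivWithin r f (Set.Ioo (-1 : ℝ) 1) x| * phi x ^ r * jac γ δ x) ''
    Set.Ioo (-1 : ℝ) 1

/-- Membership in the Sobolev-type space `W_r(u)`. -/
def MemW (γ δ : ℝ) (r : ℕ) (f : ℝ → ℝ) : Prop :=
  MemC0 γ δ f ∧ ContDiffOn ℝ r f (Set.Ioo (-1 : ℝ) 1) ∧ BddAbove (derSet γ δ r f)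

/-- The norm of `W_r(u)`: `‖fu‖ + ‖f^{(r)} φ^r u‖`. -/
noncomputable def Wnorm (γ δ : ℝ) (r : ℕ) (f : ℝ → ℝ) : ℝ :=
  wnorm γ δ f + sSup (derSet γ δ r f)

/-- The set of values `(n+1)^r E_n(f)_u`, `n ≥ 1`. -/
noncomputable def zSet (γ δ r : ℝ) (f : ℝ → ℝ) : Set ℝ :=
  (fun n : ℕ => ((n : ℝ) + 1) ^ r * bestE γ δ n f) '' {n : ℕ | 1 ≤ n}

/-- Membership in the Hölder–Zygmund space `Z_r(u)`. -/
def MemZ (γ δ r : ℝ) (f : ℝ → ℝ) : Prop := MemC0 γ δ f ∧ BddAbove (zSet γ δ r f)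

/-- The norm of `Z_r(u)`: `‖fu‖ + sup_{n≥1} (n+1)^r E_n(f)_u`. -/
noncomputable def Znorm (γ δ r : ℝ) (f : ℝ → ℝ) : ℝ :=
  wnorm γ δ f + sSup (zSet γ δ r f)

/-- Exponents `(γ,δ)` of the weight `u = sqrt(w·φ)`. -/
def uExp : ChebKind → ℝ × ℝ
  | .one => (0, 0) | .two => (1 / 2, 1 / 2) | .three => (0, 1 / 2) | .four => (1 / 2, 0)

/-- The constant `C_w`. -/
def Cw : ChebKind → ℝ | .one => 2 | _ => 1

/-- The quantity `n_w`. -/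
noncomputable def nw : ChebKind → ℕ → ℝ
  | .one, n => n | .two, n => n + 1
  | .three, n => (2 * (n : ℝ) + 1) / 2 | .four, n => (2 * (n : ℝ) + 1) / 2

/-- The quantity `m_w`. -/
noncomputable def mw : ChebKind → ℕ → ℕ → ℝ
  | .one, n, m => (n : ℝ) + m | .two, n, m => (n : ℝ) + m
  | .three, n, m => 2 * ((n : ℝ) + m) - 1 | .four, n, m => 2 * ((n : ℝ) + m) - 1

/-- The polynomials `q_{n,j}^m(w,·)` (orthogonal VP basis). -/
noncomputable def qq (w : ChebKind) (n m j : ℕ) (x : ℝ) : ℝ :=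
  if j ≤ n - m then pEval w j x
  else ((m : ℝ) + n - j) / (2 * m) * pEval w j x
    - ((m : ℝ) + j - n) / (2 * m) * pEval w (2 * n - j) x

end

/-- A kernel bounded by both `1` and `D⁻²` decays like `(1 + D)^(-τ)` for every `τ ≤ 2`. -/
theorem kernel_decay {M D τ : ℝ} (hM : 0 ≤ M) (hM1 : M ≤ 1) (hD : 0 ≤ D) (hMD : M * D ^ 2 ≤ 1)
    (hτ : τ ≤ 2) : M ≤ 4 * (1 + D) ^ (-τ) := by
  have h1 : (1 + D) ^ (-2 : ℝ) ≤ (1 + D) ^ (-τ) :=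
    Real.rpow_le_rpow_of_exponent_le (by linarith) (by linarith)
  have h2 : (1 + D) ^ (-2 : ℝ) = 1 / (1 + D) ^ 2 := by
    rw [Real.rpow_neg (by linarith), one_div]; norm_cast
  have h3 : M ≤ 4 * (1 / (1 + D) ^ 2) := by
    rw [← mul_div_assoc, le_div_iff₀ (by positivity)]
    nlinarith [mul_nonneg hM (sq_nonneg (D - 1))]
  linarith

/-- A kernel times a power of one endpoint factor. -/
theorem kernel_mul_rpow_le {a a' d N M S p τ : ℝ} (ha : 0 < a) (ha' : 0 < a') (hd : |a - a'| ≤ d)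
    (hN : 0 < N) (hNa : 1 ≤ 2 * N * a') (hM : 0 ≤ M) (hM1 : M ≤ 1) (hMS : M * (N * d) ^ 2 ≤ S)
    (hS0 : 0 ≤ S) (hS1 : S ≤ 1) (hSp : p < 0 → S ≤ 2 * N * a) (hp2 : p ≤ 2) (hpτ : -p ≤ 2 - τ)
    (hτ1 : 1 < τ) (hτ2 : τ ≤ 2) :
    M * (a / a') ^ p ≤ 64 * ((1 + N * d) ^ (-τ) + (2 * N * a') ^ (-τ)) := by
  have hd0 : 0 ≤ d := (abs_nonneg _).trans hd
  have hD0 : 0 ≤ N * d := by positivity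
  obtain ⟨hd1, hd2⟩ := abs_le.mp hd
  have hk := kernel_decay hM hM1 hD0 (hMS.trans hS1) hτ2
  have hX : 0 < (1 + N * d) ^ (-τ) := by positivity
  have hY : 0 < (2 * N * a') ^ (-τ) := by positivity
  rcases le_or_gt 0 p with hp | hp
  · have h1 : (a / a') ^ p ≤ 2 + 2 * (d / a') ^ 2 := by
      calc (a / a') ^ p ≤ (1 + d / a') ^ p := by
            refine Real.rpow_le_rpow (by positivity) ?_ hp
            rw [div_le_iff₀ ha', add_mul, div_mul_cancel₀ _ ha'.ne']
            linarith
        _ ≤ (1 + d / a') ^ (2 : ℝ) :=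
            Real.rpow_le_rpow_of_exponent_le (le_add_of_nonneg_right (by positivity)) hp2
        _ = (1 + d / a') ^ 2 := by norm_cast
        _ ≤ 2 + 2 * (d / a') ^ 2 := by nlinarith [sq_nonneg (d / a' - 1)]
    have h2 : M * (d / a') ^ 2 ≤ 4 * (2 * N * a') ^ (-τ) := by
      have h3 : (2 * N * a') ^ (-2 : ℝ) ≤ (2 * N * a') ^ (-τ) :=
        Real.rpow_le_rpow_of_exponent_le hNa (by linarith)
      have h4 : (2 * N * a') ^ (-2 : ℝ) = 1 / (2 * N * a') ^ 2 := by
        rw [Real.rpow_neg (by positivity), one_div]; norm_cast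
      have h5 : M * (d / a') ^ 2 = 4 * (M * (N * d) ^ 2 * (1 / (2 * N * a') ^ 2)) := by
        field_simp; ring
      have h6 : M * (N * d) ^ 2 * (1 / (2 * N * a') ^ 2) ≤ 1 * (1 / (2 * N * a') ^ 2) :=
        mul_le_mul_of_nonneg_right (hMS.trans hS1) (by positivity)
      linarith
    nlinarith [mul_le_mul_of_nonneg_left h1 hM]
  · have hr : (a / a') ^ p = (a' / a) ^ (-p) := by
      rw [Real.rpow_neg (by positivity), ← Real.inv_rpow (by positivity), inv_div]
    rw [hr]
    rcases le_or_gt d a with hda | hda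
    · have h1 : (a' / a) ^ (-p) ≤ 2 := by
        calc (a' / a) ^ (-p) ≤ 2 ^ (-p) := by
              refine Real.rpow_le_rpow (by positivity) ?_ (by linarith)
              rw [div_le_iff₀ ha]; linarith
          _ ≤ 2 ^ (1 : ℝ) := Real.rpow_le_rpow_of_exponent_le (by norm_num) (by linarith)
          _ = 2 := Real.rpow_one 2
      nlinarith [mul_le_mul_of_nonneg_left h1 hM]
    · have hd' : 0 < d := ha.trans hda
      have hD : 1 ≤ 4 * (N * d) := by nlinarith
      have h1 : (a' / a) ^ (-p) ≤ (2 * d / a) ^ (-p) := by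
        refine Real.rpow_le_rpow (by positivity) ?_ (by linarith)
        gcongr; linarith
      have h2 : S ≤ (2 * N * a) ^ (-p) := by
        rcases hS0.eq_or_lt with h | h
        · rw [← h]; positivity
        calc S = S ^ (1 : ℝ) := (Real.rpow_one S).symm
          _ ≤ S ^ (-p) := Real.rpow_le_rpow_of_exponent_ge h hS1 (by linarith)
          _ ≤ (2 * N * a) ^ (-p) := Real.rpow_le_rpow hS0 (hSp hp) (by linarith)
      have h3 : M ≤ 16 * (S * (4 * (N * d)) ^ (-2 : ℝ)) := by
        have : (4 * (N * d)) ^ (-2 : ℝ) = 1 / (4 * (N * d)) ^ 2 := by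
          rw [Real.rpow_neg (by positivity), one_div]; norm_cast
        rw [this, ← mul_div_assoc, ← mul_div_assoc, le_div_iff₀ (by positivity)]
        nlinarith
      have h4 : (2 * N * a) ^ (-p) * (2 * d / a) ^ (-p) = (4 * (N * d)) ^ (-p) := by
        rw [← Real.mul_rpow (by positivity) (by positivity)]
        congr 1; field_simp; ring
      have h5 : (4 * (N * d)) ^ (-2 : ℝ) * (4 * (N * d)) ^ (-p) ≤ 4 * (1 + N * d) ^ (-τ) := by
        rw [← Real.rpow_add (by positivity)]
        calc (4 * (N * d)) ^ (-2 + -p) ≤ (4 * (N * d)) ^ (-τ) :=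
              Real.rpow_le_rpow_of_exponent_le hD (by linarith)
          _ ≤ ((1 + N * d) / 2) ^ (-τ) :=
              Real.rpow_le_rpow_of_nonpos (by positivity) (by linarith) (by linarith)
          _ = 2 ^ τ * (1 + N * d) ^ (-τ) := by
              rw [Real.div_rpow (by positivity) (by norm_num), Real.rpow_neg (by norm_num : (0 : ℝ) ≤ 2)]
              field_simp
          _ ≤ 4 * (1 + N * d) ^ (-τ) := by
              gcongr
              calc (2 : ℝ) ^ τ ≤ 2 ^ (2 : ℝ) :=
                    Real.rpow_le_rpow_of_exponent_le (by norm_num) hτ2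
                _ = 4 := by norm_num
      calc M * (a' / a) ^ (-p)
          ≤ (16 * ((2 * N * a) ^ (-p) * (4 * (N * d)) ^ (-2 : ℝ))) * (2 * d / a) ^ (-p) := by
            refine mul_le_mul (h3.trans ?_) h1 (by positivity) (by positivity)
            gcongr
        _ = 16 * ((4 * (N * d)) ^ (-2 : ℝ) * (4 * (N * d)) ^ (-p)) := by rw [← h4]; ring
        _ ≤ 64 * ((1 + N * d) ^ (-τ) + (2 * N * a') ^ (-τ)) := by linarith

/-- The kernel bound when the two points lie near opposite endpoints. -/
theorem kernel_mul_rpow_far_le {a b a' b' d N M S p q τ : ℝ} (ha : 0 < a) (hb : 0 < b)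
    (ha' : 0 < a') (hb' : 0 < b') (hb1 : b ≤ 1) (ha'1 : a' ≤ 1) (hb'1 : b' ≤ 1)
    (hd : 1 / 2 ≤ d) (hN : 0 < N) (hNb : 1 ≤ 2 * N * b') (hMS : M * (N * d) ^ 2 ≤ S)
    (hM : 0 ≤ M) (hS0 : 0 ≤ S) (hS1 : S ≤ 1) (hSp : S ≤ 2 * N * a) (hp : p < 0) (hp1 : -1 ≤ p)
    (hq : 0 ≤ q) (hqp : q - p ≤ 2) (hpτ : -p ≤ 2 - τ) :
    M * ((a / a') ^ p * (b / b') ^ q) ≤ 16 * (2 * N * b') ^ (-τ) := by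
  have h1 : (a / a') ^ p ≤ a ^ p := by
    refine Real.rpow_le_rpow_of_nonpos ha ?_ hp.le
    rw [le_div_iff₀ ha']; nlinarith
  have h2 : (b / b') ^ q ≤ b' ^ (-2 - p) := by
    calc (b / b') ^ q ≤ (1 / b') ^ q := by gcongr
      _ = b' ^ (-q) := by rw [one_div, Real.inv_rpow hb'.le, Real.rpow_neg hb'.le]
      _ ≤ b' ^ (-2 - p) := Real.rpow_le_rpow_of_exponent_ge hb' hb'1 (by linarith)
  have h3 : S ≤ (2 * N * a) ^ (-p) := by
    rcases hS0.eq_or_lt with h | h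
    · rw [← h]; positivity
    calc S = S ^ (1 : ℝ) := (Real.rpow_one S).symm
      _ ≤ S ^ (-p) := Real.rpow_le_rpow_of_exponent_ge h hS1 (by linarith)
      _ ≤ (2 * N * a) ^ (-p) := Real.rpow_le_rpow hS0 hSp (by linarith)
  have h4 : M ≤ 16 * ((2 * N * a) ^ (-p) * (2 * N) ^ (-2 : ℝ)) := by
    have : (2 * N) ^ (-2 : ℝ) = 1 / (2 * N) ^ 2 := by
      rw [Real.rpow_neg (by positivity), one_div]; norm_cast
    rw [this, ← mul_div_assoc, ← mul_div_assoc, le_div_iff₀ (by positivity)]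
    have : M * N ^ 2 * (1 / 4) ≤ M * N ^ 2 * d ^ 2 := by gcongr; nlinarith
    nlinarith
  calc M * ((a / a') ^ p * (b / b') ^ q)
      ≤ (16 * ((2 * N * a) ^ (-p) * (2 * N) ^ (-2 : ℝ))) * (a ^ p * b' ^ (-2 - p)) := by
        gcongr
    _ = 16 * (2 * N * b') ^ (-2 - p) := by
        have e1 : (2 * N * a) ^ (-p) = (2 * N) ^ (-p) * a ^ (-p) :=
          Real.mul_rpow (by positivity) ha.le
        have e2 : a ^ (-p) * a ^ p = 1 := by rw [← Real.rpow_add ha]; simp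
        have e3 : (2 * N) ^ (-p) * (2 * N) ^ (-2 : ℝ) = (2 * N) ^ (-2 - p) := by
          rw [← Real.rpow_add (by positivity)]; ring_nf
        rw [Real.mul_rpow (by positivity : 0 ≤ 2 * N) hb'.le, ← e3, e1]
        linear_combination (16 * (2 * N) ^ (-p) * (2 * N) ^ (-2 : ℝ) * b' ^ (-2 - p)) * e2
    _ ≤ 16 * (2 * N * b') ^ (-τ) := by
        gcongr
        linarith

theorem div_rpow_le_four {a a' p : ℝ} (ha : 0 < a) (ha' : 0 < a') (ha1 : a ≤ 1) (ha'1 : a' ≤ 1)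
    (hp2 : p ≤ 2) (hp1 : -1 ≤ p) (h : (0 ≤ p ∧ 1 / 2 ≤ a') ∨ (p < 0 ∧ 1 / 2 ≤ a)) :
    (a / a') ^ p ≤ 4 := by
  rcases h with ⟨hp, h⟩ | ⟨hp, h⟩
  · calc (a / a') ^ p ≤ 2 ^ p := by
          refine Real.rpow_le_rpow (by positivity) ?_ hp
          rw [div_le_iff₀ ha']; linarith
      _ ≤ 2 ^ (2 : ℝ) := Real.rpow_le_rpow_of_exponent_le (by norm_num) hp2
      _ = 4 := by norm_num
  · calc (a / a') ^ p = (a' / a) ^ (-p) := by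
          rw [Real.rpow_neg (by positivity), ← Real.inv_rpow (by positivity), inv_div]
      _ ≤ 2 ^ (-p) := by
          refine Real.rpow_le_rpow (by positivity) ?_ (by linarith)
          rw [div_le_iff₀ ha]; linarith
      _ ≤ 2 ^ (2 : ℝ) := Real.rpow_le_rpow_of_exponent_le (by norm_num) (by linarith)
      _ = 4 := by norm_num

theorem abs_sub_le_abs_cross {a b a' b' : ℝ} (ha : 0 ≤ a) (hb : 0 ≤ b) (ha' : 0 ≤ a')
    (hb' : 0 ≤ b') (hab : a ^ 2 + b ^ 2 = 1) (hab' : a' ^ 2 + b' ^ 2 = 1) :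
    |a - a'| ≤ |a * b' - a' * b| := by
  have hc : a * a' + b * b' ≤ 1 := by nlinarith [sq_nonneg (a - a'), sq_nonneg (b - b')]
  have hb1 : b ≤ 1 := by nlinarith
  have hb'1 : b' ≤ 1 := by nlinarith
  have h1 : a - a' = b' * (a * b' - a' * b) - a' * (1 - (a * a' + b * b')) := by
    linear_combination (-a) * hab'
  have h2 : a' - a = b * (-(a * b' - a' * b)) - a * (1 - (a * a' + b * b')) := by
    linear_combination (-a') * hab
  rw [abs_le']
  constructor
  · have : b' * (a * b' - a' * b) ≤ 1 * |a * b' - a' * b| :=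
      mul_le_mul_of_nonneg hb'1 (le_abs_self _) hb' (abs_nonneg _)
    nlinarith [mul_nonneg ha' (sub_nonneg.mpr hc)]
  · have : b * (-(a * b' - a' * b)) ≤ 1 * |a * b' - a' * b| :=
      mul_le_mul_of_nonneg hb1 (neg_le_abs _) hb (abs_nonneg _)
    rw [neg_sub]
    nlinarith [mul_nonneg ha (sub_nonneg.mpr hc)]

theorem half_le_cross {a b a' b' : ℝ} (ha : 0 ≤ a) (hb : 0 ≤ b) (ha' : 0 ≤ a') (hb' : 0 ≤ b')
    (hab : a ^ 2 + b ^ 2 = 1) (hab' : a' ^ 2 + b' ^ 2 = 1) (ha2 : a ≤ 1 / 2) (hb2 : b' ≤ 1 / 2) :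
    1 / 2 ≤ a' * b - a * b' := by
  have h1 : a * b' ≤ 1 / 2 * (1 / 2) := mul_le_mul ha2 hb2 hb' (by norm_num)
  have h2 : 3 / 4 ≤ b ^ 2 := by nlinarith
  have h3 : 3 / 4 ≤ a' ^ 2 := by nlinarith
  have h4 : (3 / 4) ^ 2 ≤ (a' * b) ^ 2 := by rw [mul_pow]; nlinarith
  have h5 : 3 / 4 ≤ a' * b := (sq_le_sq₀ (by norm_num) (by positivity)).mp h4
  linarith

/-- A kernel times powers of both endpoint factors. -/
theorem kernel_mul_rpow_mul_rpow_le {a b a' b' N M S p q τ : ℝ} (ha : 0 < a) (hb : 0 < b)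
    (ha' : 0 < a') (hb' : 0 < b') (hab : a ^ 2 + b ^ 2 = 1) (hab' : a' ^ 2 + b' ^ 2 = 1)
    (hN : 0 < N) (hNa : 1 ≤ 2 * N * a') (hNb : 1 ≤ 2 * N * b') (hM : 0 ≤ M) (hM1 : M ≤ 1)
    (hMS : M * (N * |a * b' - a' * b|) ^ 2 ≤ S) (hS0 : 0 ≤ S) (hS1 : S ≤ 1)
    (hSp : p < 0 → S ≤ 2 * N * a) (hSq : q < 0 → S ≤ 2 * N * b) (hp2 : p ≤ 2) (hq2 : q ≤ 2)
    (hpτ : -p ≤ 2 - τ) (hqτ : -q ≤ 2 - τ) (hpq : p - q ≤ 2) (hqp : q - p ≤ 2)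
    (hτ1 : 1 < τ) (hτ2 : τ ≤ 2) :
    M * ((a / a') ^ p * (b / b') ^ q) ≤
      256 * ((1 + N * |a * b' - a' * b|) ^ (-τ) + (2 * N * a') ^ (-τ) + (2 * N * b') ^ (-τ)) := by
  have ha1 : a ≤ 1 := by nlinarith only [hab, ha, sq_nonneg b]
  have hb1 : b ≤ 1 := by nlinarith only [hab, hb, sq_nonneg a]
  have ha'1 : a' ≤ 1 := by nlinarith only [hab', ha', sq_nonneg b']
  have hb'1 : b' ≤ 1 := by nlinarith only [hab', hb', sq_nonneg a']
  have hX : 0 < (1 + N * |a * b' - a' * b|) ^ (-τ) := by positivity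
  have hY : 0 < (2 * N * a') ^ (-τ) := by positivity
  have hZ : 0 < (2 * N * b') ^ (-τ) := by positivity
  have hA0 : 0 < (a / a') ^ p := by positivity
  have hB0 : 0 < (b / b') ^ q := by positivity
  have hda := abs_sub_le_abs_cross ha.le hb.le ha'.le hb'.le hab hab'
  have hdb : |b - b'| ≤ |a * b' - a' * b| := by
    have := abs_sub_le_abs_cross hb.le ha.le hb'.le ha'.le (by linarith) (by linarith)
    rwa [← abs_neg (b * a' - b' * a), show -(b * a' - b' * a) = a * b' - a' * b by ring] at this
  by_cases hga : (0 ≤ p ∧ 1 / 2 ≤ a') ∨ (p < 0 ∧ 1 / 2 ≤ a)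
  · have hA := div_rpow_le_four ha ha' ha1 ha'1 hp2 (by linarith) hga
    have hB := kernel_mul_rpow_le hb hb' hdb hN hNb hM hM1 hMS hS0 hS1 hSq hq2 hqτ hτ1 hτ2
    have : M * (b / b') ^ q * (a / a') ^ p ≤ M * (b / b') ^ q * 4 := by gcongr
    rw [mul_comm ((a / a') ^ p), ← mul_assoc]
    linarith
  by_cases hgb : (0 ≤ q ∧ 1 / 2 ≤ b') ∨ (q < 0 ∧ 1 / 2 ≤ b)
  · have hB := div_rpow_le_four hb hb' hb1 hb'1 hq2 (by linarith) hgb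
    have hA := kernel_mul_rpow_le ha ha' hda hN hNa hM hM1 hMS hS0 hS1 hSp hp2 hpτ hτ1 hτ2
    have : M * (a / a') ^ p * (b / b') ^ q ≤ M * (a / a') ^ p * 4 := by gcongr
    rw [← mul_assoc]
    linarith
  rw [not_or, not_and, not_and, not_le, not_le] at hga hgb
  rcases le_or_gt 0 p with hp | hp
  · have h1 := hga.1 hp
    rcases le_or_gt 0 q with hq | hq
    · have h2 := hgb.1 hq
      have : a' ^ 2 ≤ (1 / 2) ^ 2 := by gcongr
      have : b' ^ 2 ≤ (1 / 2) ^ 2 := by gcongr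
      linarith
    · have h2 := hgb.2 hq
      have hd : 1 / 2 ≤ |a * b' - a' * b| :=
        (half_le_cross hb.le ha.le hb'.le ha'.le (by linarith) (by linarith) h2.le h1.le).trans
          ((le_abs_self _).trans' (by linarith))
      have := kernel_mul_rpow_far_le hb ha hb' ha' ha1 hb'1 ha'1 hd hN hNa hMS hM hS0 hS1 (hSq hq)
        hq (by linarith) hp hpq hqτ
      rw [mul_comm ((a / a') ^ p)]
      linarith
  · have h1 := hga.2 hp
    rcases le_or_gt 0 q with hq | hq
    · have h2 := hgb.1 hq
      have hd : 1 / 2 ≤ |a * b' - a' * b| :=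
        (half_le_cross ha.le hb.le ha'.le hb'.le hab hab' h1.le h2.le).trans
          ((neg_le_abs _).trans' (by linarith))
      have := kernel_mul_rpow_far_le ha hb ha' hb' hb1 ha'1 hb'1 hd hN hNb hMS hM hS0 hS1 (hSp hp)
        hp (by linarith) hq hqp hpτ
      linarith
    · have h2 := hgb.2 hq
      have : a ^ 2 ≤ (1 / 2) ^ 2 := by gcongr
      have : b ^ 2 ≤ (1 / 2) ^ 2 := by gcongr
      linarith

theorem summable_one_add_abs_int_rpow {τ : ℝ} (hτ : 1 < τ) :
    Summable fun j : ℤ => (1 + |(j : ℝ)|) ^ (-τ) := by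
  have h : Summable fun n : ℕ => (1 + (n : ℝ)) ^ (-τ) := by
    have := (summable_nat_add_iff 1).mpr (Real.summable_nat_rpow.mpr (neg_lt_neg hτ))
    refine this.congr fun n => ?_
    push_cast
    rw [add_comm]
  apply Summable.of_nat_of_neg <;> simpa using h

theorem exists_sum_one_add_abs_sub_rpow_le {τ : ℝ} (hτ : 1 < τ) :
    ∃ Z : ℝ, 0 < Z ∧ ∀ (A : Finset ℕ) (i : ℤ),
      ∑ k ∈ A, (1 + |(k : ℝ) - i|) ^ (-τ) ≤ Z := by
  have hs := summable_one_add_abs_int_rpow hτ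
  refine ⟨∑' j : ℤ, (1 + |(j : ℝ)|) ^ (-τ), ?_, fun A i => ?_⟩
  · exact hs.tsum_pos (fun _ => by positivity) 0 (by positivity)
  · have hinj : Function.Injective fun k : ℕ => (k : ℤ) - i := fun x y hxy => by
      simpa using hxy
    have := hs.sum_le_tsum (A.map ⟨_, hinj⟩) (fun _ _ => by positivity)
    simpa using this

theorem div_pi_le_sin_half {x : ℝ} (h0 : 0 ≤ x) (h1 : x ≤ π) : x / π ≤ Real.sin (x / 2) := by
  have := Real.mul_le_sin (x := x / 2) (by linarith) (by linarith)
  calc x / π = 2 / π * (x / 2) := by ring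
    _ ≤ _ := this

/-- Uniform boundedness of weighted kernel sums over equispaced angles. -/
theorem exists_weighted_kernel_sum_le {p q : ℝ} (hp1 : -1 < p) (hq1 : -1 < q) (hp2 : p ≤ 2)
    (hq2 : q ≤ 2) (hpq : p - q ≤ 2) (hqp : q - p ≤ 2) :
    ∃ C : ℝ, 0 < C ∧ ∀ (n : ℕ) (N σ t S : ℝ) (M s : ℕ → ℝ), 0 < N → 0 < t → t < π →
      (∀ k, s k = (k - σ) * π / N) →
      (∀ k ∈ Finset.Icc 1 n, (k : ℝ) * π / (2 * N) ≤ s k) →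
      (∀ k ∈ Finset.Icc 1 n, (n + 1 - k : ℝ) * π / (2 * N) ≤ π - s k) →
      (∀ k ∈ Finset.Icc 1 n, 0 ≤ M k ∧ M k ≤ 1 ∧
        M k * (N * |Real.sin ((t - s k) / 2)|) ^ 2 ≤ S) →
      |σ| ≤ 1 → 0 ≤ S → S ≤ 1 → (p < 0 → S ≤ 2 * N * Real.sin (t / 2)) →
      (q < 0 → S ≤ 2 * N * Real.cos (t / 2)) →
      ∑ k ∈ Finset.Icc 1 n, M k * ((Real.sin (t / 2) / Real.sin (s k / 2)) ^ p *
        (Real.cos (t / 2) / Real.cos (s k / 2)) ^ q) ≤ C := by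
  obtain ⟨τ, hτ1, hτ2, hpτ, hqτ⟩ : ∃ τ : ℝ, 1 < τ ∧ τ ≤ 2 ∧ -p ≤ 2 - τ ∧ -q ≤ 2 - τ := by
    refine ⟨2 - max 0 (max (-p) (-q)), ?_, ?_, ?_, ?_⟩
    · have : max 0 (max (-p) (-q)) < 1 := by
        rw [max_lt_iff, max_lt_iff]; exact ⟨by norm_num, by linarith, by linarith⟩
      linarith
    · have := le_max_left 0 (max (-p) (-q)); linarith
    · have := (le_max_left (-p) (-q)).trans (le_max_right 0 (max (-p) (-q))); linarith
    · have := (le_max_right (-p) (-q)).trans (le_max_right 0 (max (-p) (-q))); linarith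
  obtain ⟨Z, hZ, hsum⟩ := exists_sum_one_add_abs_sub_rpow_le hτ1
  refine ⟨256 * (16 * Z + Z + Z), by positivity, ?_⟩
  intro n N σ t S M s hN ht0 htπ hs hs0 hsπ hM hσ hS0 hS1 hSp hSq
  have hπ := Real.pi_pos
  have key : ∀ k ∈ Finset.Icc 1 n, M k * ((Real.sin (t / 2) / Real.sin (s k / 2)) ^ p *
        (Real.cos (t / 2) / Real.cos (s k / 2)) ^ q) ≤
      256 * (16 * (1 + |(k : ℝ) - (⌊N * t / π⌋ : ℤ)|) ^ (-τ) +
        (1 + |(k : ℝ) - (1 : ℤ)|) ^ (-τ) + (1 + |(k : ℝ) - (n : ℤ)|) ^ (-τ)) := by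
    intro k hk
    obtain ⟨hM0, hM1, hMS⟩ := hM k hk
    have hk' := Finset.mem_Icc.mp hk
    have hk1 : (1 : ℝ) ≤ k := by exact_mod_cast hk'.1
    have hkn : (k : ℝ) ≤ n := by exact_mod_cast hk'.2
    have h0 := hs0 k hk
    have h1 := hsπ k hk
    have h0' : 0 < (k : ℝ) * π / (2 * N) := by positivity
    have h1' : 0 < (n + 1 - k : ℝ) * π / (2 * N) := by
      have : (0 : ℝ) < n + 1 - k := by linarith
      positivity
    have hsin : (k : ℝ) ≤ 2 * N * Real.sin (s k / 2) := by
      have := div_pi_le_sin_half (x := s k) (by linarith) (by linarith)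
      have h2 : (k : ℝ) / (2 * N) ≤ s k / π := by
        rw [le_div_iff₀ hπ]; calc _ = (k : ℝ) * π / (2 * N) := by ring
          _ ≤ _ := h0
      have h3 := h2.trans this
      rw [div_le_iff₀ (by positivity)] at h3
      linarith
    have hcos : (n + 1 - k : ℝ) ≤ 2 * N * Real.cos (s k / 2) := by
      have := div_pi_le_sin_half (x := π - s k) (by linarith) (by linarith)
      rw [show (π - s k) / 2 = π / 2 - s k / 2 by ring, Real.sin_pi_div_two_sub] at this
      have h2 : (n + 1 - k : ℝ) / (2 * N) ≤ (π - s k) / π := by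
        rw [le_div_iff₀ hπ]; calc _ = (n + 1 - k : ℝ) * π / (2 * N) := by ring
          _ ≤ _ := h1
      have h3 := h2.trans this
      rw [div_le_iff₀ (by positivity)] at h3
      linarith
    have hd : Real.sin ((t - s k) / 2) = Real.sin (t / 2) * Real.cos (s k / 2) -
        Real.sin (s k / 2) * Real.cos (t / 2) := by
      rw [sub_div, Real.sin_sub]; ring
    have hdist : |N * t / π - (k - σ)| ≤ N * |Real.sin ((t - s k) / 2)| := by
      have h4 : N * t / π - (k - σ) = N * ((t - s k) / π) := by
        rw [hs k]; field_simp
      rw [h4, abs_mul, abs_of_pos hN]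
      refine mul_le_mul_of_nonneg_left ?_ hN.le
      rw [abs_div, abs_of_pos hπ]
      rcases le_total 0 (t - s k) with h | h
      · rw [abs_of_nonneg h]
        exact (div_pi_le_sin_half h (by linarith)).trans (le_abs_self _)
      · rw [abs_of_nonpos h]
        refine (div_pi_le_sin_half (by linarith) (by linarith)).trans ?_
        rw [neg_div, Real.sin_neg]
        exact neg_le_abs _
    have hsp : 0 < Real.sin (s k / 2) := Real.sin_pos_of_pos_of_lt_pi (by linarith) (by linarith)
    have hcp : 0 < Real.cos (s k / 2) :=
      Real.cos_pos_of_mem_Ioo ⟨by linarith, by linarith⟩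
    have hst : 0 < Real.sin (t / 2) := Real.sin_pos_of_pos_of_lt_pi (by linarith) (by linarith)
    have hct : 0 < Real.cos (t / 2) := Real.cos_pos_of_mem_Ioo ⟨by linarith, by linarith⟩
    have main := kernel_mul_rpow_mul_rpow_le hst hct hsp hcp (Real.sin_sq_add_cos_sq _)
      (Real.sin_sq_add_cos_sq _) hN (hk1.trans hsin) (le_trans (by linarith) hcos) hM0 hM1
      (by rwa [← hd]) hS0 hS1 hSp hSq hp2 hq2 hpτ hqτ hpq hqp hτ1 hτ2
    refine main.trans ?_
    rw [← hd]
    have e1 : (1 + N * |Real.sin ((t - s k) / 2)|) ^ (-τ) ≤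
        16 * (1 + |(k : ℝ) - (⌊N * t / π⌋ : ℤ)|) ^ (-τ) := by
      have hfl := Int.floor_le (N * t / π)
      have hfl' := Int.lt_floor_add_one (N * t / π)
      have h5 : (1 + |(k : ℝ) - (⌊N * t / π⌋ : ℤ)|) / 4 ≤ 1 + N * |Real.sin ((t - s k) / 2)| := by
        have : |(k : ℝ) - (⌊N * t / π⌋ : ℤ)| ≤ |N * t / π - (k - σ)| + 2 := by
          have := abs_le.mp hσ
          have h6 := le_abs_self (N * t / π - (k - σ))
          have h7 := neg_le_abs (N * t / π - (k - σ))
          rw [abs_le]; constructor <;> linarith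
        have := abs_nonneg (N * t / π - (k - σ))
        linarith
      calc (1 + N * |Real.sin ((t - s k) / 2)|) ^ (-τ)
          ≤ ((1 + |(k : ℝ) - (⌊N * t / π⌋ : ℤ)|) / 4) ^ (-τ) :=
            Real.rpow_le_rpow_of_nonpos (by positivity) h5 (by linarith)
        _ = 4 ^ τ * (1 + |(k : ℝ) - (⌊N * t / π⌋ : ℤ)|) ^ (-τ) := by
            rw [Real.div_rpow (by positivity) (by norm_num), Real.rpow_neg (by norm_num : (0 : ℝ) ≤ 4)]
            field_simp
        _ ≤ 16 * (1 + |(k : ℝ) - (⌊N * t / π⌋ : ℤ)|) ^ (-τ) := by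
            gcongr
            calc (4 : ℝ) ^ τ ≤ 4 ^ (2 : ℝ) :=
                  Real.rpow_le_rpow_of_exponent_le (by norm_num) hτ2
              _ = 16 := by norm_num
    have e2 : (2 * N * Real.sin (s k / 2)) ^ (-τ) ≤ (1 + |(k : ℝ) - (1 : ℤ)|) ^ (-τ) := by
      refine Real.rpow_le_rpow_of_nonpos (by positivity) ?_ (by linarith)
      push_cast
      rw [abs_of_nonneg (by linarith)]; linarith
    have e3 : (2 * N * Real.cos (s k / 2)) ^ (-τ) ≤ (1 + |(k : ℝ) - (n : ℤ)|) ^ (-τ) := by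
      refine Real.rpow_le_rpow_of_nonpos (by positivity) ?_ (by linarith)
      push_cast
      rw [abs_of_nonpos (by linarith)]; linarith
    linarith
  refine (Finset.sum_le_sum key).trans ?_
  rw [← Finset.mul_sum, Finset.sum_add_distrib, Finset.sum_add_distrib, ← Finset.mul_sum]
  gcongr
  · exact hsum (Finset.Icc 1 n) ⌊N * t / π⌋
  · exact hsum (Finset.Icc 1 n) 1
  · exact hsum (Finset.Icc 1 n) n

/-- Twice the frequency shift: `p_j(w, cos t)` oscillates with frequency `j + freqShift w / 2`. -/
def freqShift : ChebKind → ℕ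
  | .one => 0 | .two => 2 | .three => 1 | .four => 1

/-- The trigonometric function underlying each Chebyshev kind. -/
noncomputable def trigFn : ChebKind → ℝ → ℝ
  | .one => Real.cos | .two => Real.sin | .three => Real.cos | .four => Real.sin

/-- The sign in `2 trig x trig y = cos (x - y) + trigSign cos (x + y)`. -/
def trigSign : ChebKind → ℝ
  | .one => 1 | .two => -1 | .three => 1 | .four => -1

/-- The denominator in the trigonometric form of `p_j(w, cos t)`. -/
noncomputable def trigDenom : ChebKind → ℝ → ℝ
  | .one, _ => 1 | .two, t => Real.sin t
  | .three, t => Real.cos (t / 2) | .four, t => Real.sin (t / 2)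

/-- The normalising constant of `p_j(w, ·)`. -/
noncomputable def trigNorm : ChebKind → ℕ → ℝ
  | .one, 0 => 1 / Real.sqrt π | .one, _ + 1 => Real.sqrt (2 / π)
  | .two, _ => Real.sqrt (2 / π) | .three, _ => 1 / Real.sqrt π | .four, _ => 1 / Real.sqrt π

/-- The constant in `λ_k = lamCoeff π / n_w trigDenom(t_k)²`. -/
def lamCoeff : ChebKind → ℝ
  | .one => 1 | .two => 1 | .three => 2 | .four => 2

/-- The offset in `t_k = (k - nodeOffset) π / n_w`. -/
noncomputable def nodeOffset : ChebKind → ℝ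
  | .one => 1 / 2 | .two => 0 | .three => 1 / 2 | .four => 0

theorem nw_eq (w : ChebKind) (n : ℕ) : nw w n = n + (freqShift w : ℝ) / 2 := by
  cases w <;> simp [nw, freqShift]; all_goals ring

theorem le_nw (w : ChebKind) (n : ℕ) : (n : ℝ) ≤ nw w n := by
  rw [nw_eq]; exact le_add_of_nonneg_right (by positivity)

theorem nw_le (w : ChebKind) (n : ℕ) : nw w n ≤ n + 1 := by
  rw [nw_eq]; cases w <;> norm_num [freqShift]

theorem nw_pos (w : ChebKind) {n : ℕ} (hn : 0 < n) : 0 < nw w n :=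
  (Nat.cast_pos.mpr hn).trans_le (le_nw w n)

theorem two_mul_trigFn_mul (w : ChebKind) (x y : ℝ) :
    2 * (trigFn w x * trigFn w y) = Real.cos (x - y) + trigSign w * Real.cos (x + y) := by
  cases w <;> simp only [trigFn, trigSign, Real.cos_sub, Real.cos_add] <;> ring

theorem abs_trigFn_le_one (w : ChebKind) (x : ℝ) : |trigFn w x| ≤ 1 := by
  cases w <;> simp only [trigFn, Real.abs_cos_le_one, Real.abs_sin_le_one]

theorem trigDenom_pos (w : ChebKind) {t : ℝ} (h0 : 0 < t) (hπ : t < π) : 0 < trigDenom w t := by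
  cases w <;> simp only [trigDenom]
  · norm_num
  · exact Real.sin_pos_of_pos_of_lt_pi h0 hπ
  · exact Real.cos_pos_of_mem_Ioo ⟨by linarith, by linarith⟩
  · exact Real.sin_pos_of_pos_of_lt_pi (by linarith) (by linarith)

theorem pEval_cos_mul_trigDenom (w : ChebKind) (j : ℕ) {t : ℝ} (h0 : 0 < t) (hπ : t < π) :
    pEval w j (Real.cos t) * trigDenom w t =
      trigNorm w j * trigFn w ((j + (freqShift w : ℝ) / 2) * t) := by
  have hs : Real.sin (t / 2) ≠ 0 :=
    (Real.sin_pos_of_pos_of_lt_pi (by linarith) (by linarith)).ne'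
  have hc : Real.cos (t / 2) ≠ 0 := (Real.cos_pos_of_mem_Ioo ⟨by linarith, by linarith⟩).ne'
  have hd : Real.sin t = 2 * Real.sin (t / 2) * Real.cos (t / 2) := by
    rw [← Real.sin_two_mul]; ring_nf
  have e1 := Polynomial.Chebyshev.U_real_cos t j
  have e2 := Polynomial.Chebyshev.U_real_cos t (j - 1)
  have e3 : ((j : ℝ) + 1) * t = (j + 1 / 2) * t + t / 2 := by ring
  have e4 : (j : ℝ) * t = (j + 1 / 2) * t - t / 2 := by ring
  push_cast at e1 e2
  rw [sub_add_cancel] at e2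
  cases w
  · cases j with
    | zero => simp [pEval, pPoly, trigDenom, trigNorm, trigFn, freqShift]
    | succ j =>
      have := Polynomial.Chebyshev.T_real_cos t (j + 1)
      push_cast at this
      simp [pEval, pPoly, trigDenom, trigNorm, trigFn, freqShift, this]
  · simp [pEval, pPoly, trigDenom, trigNorm, trigFn, freqShift, mul_assoc, e1]
  · simp only [pEval, pPoly, trigDenom, trigNorm, trigFn, freqShift, Polynomial.eval_mul,
      Polynomial.eval_C, Polynomial.eval_sub, Nat.cast_one]
    rw [hd, e3, Real.sin_add] at e1
    rw [hd, e4, Real.sin_sub] at e2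
    rw [mul_assoc]
    congr 1
    refine mul_left_cancel₀ (mul_ne_zero two_ne_zero hs) ?_
    linear_combination e1 - e2
  · simp only [pEval, pPoly, trigDenom, trigNorm, trigFn, freqShift, Polynomial.eval_mul,
      Polynomial.eval_C, Polynomial.eval_add, Nat.cast_one]
    rw [hd, e3, Real.sin_add] at e1
    rw [hd, e4, Real.sin_sub] at e2
    rw [mul_assoc]
    congr 1
    refine mul_left_cancel₀ (mul_ne_zero two_ne_zero hc) ?_
    linear_combination e1 + e2

theorem tNode_eq (w : ChebKind) {n : ℕ} (hn : 0 < n) (k : ℕ) :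
    tNode w n k = (k - nodeOffset w) * π / nw w n := by
  have : (n : ℝ) ≠ 0 := by positivity
  cases w <;> simp only [tNode, nodeOffset, nw] <;> field_simp <;> ring

theorem lam_eq (w : ChebKind) {n : ℕ} (k : ℕ) :
    lam w n k = lamCoeff w * π / nw w n * trigDenom w (tNode w n k) ^ 2 := by
  cases w <;> simp only [lam, lamCoeff, nw, trigDenom] <;> field_simp
  all_goals norm_num

theorem lamCoeff_mul_trigNorm_sq (w : ChebKind) (j : ℕ) :
    lamCoeff w * π * trigNorm w j ^ 2 = 2 - if j + freqShift w = 0 then 1 else 0 := by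
  have h1 : (1 / Real.sqrt π) ^ 2 = 1 / π := by rw [div_pow, Real.sq_sqrt Real.pi_pos.le, one_pow]
  have h2 : Real.sqrt (2 / π) ^ 2 = 2 / π := Real.sq_sqrt (by positivity)
  cases w
  · cases j <;> simp only [lamCoeff, trigNorm, freqShift, h1, h2] <;> field_simp <;> norm_num
  all_goals simp only [lamCoeff, trigNorm, freqShift, h1, h2]; field_simp; norm_num

theorem mul_pi_div_le_tNode (w : ChebKind) {n k : ℕ} (hk : k ∈ Finset.Icc 1 n) :
    (k : ℝ) * π / (2 * nw w n) ≤ tNode w n k := by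
  obtain ⟨h1, h2⟩ := Finset.mem_Icc.mp hk
  have hN := nw_pos w (h1.trans h2)
  have hk1 : (1 : ℝ) ≤ k := by exact_mod_cast h1
  have hσ : nodeOffset w ≤ 1 / 2 := by cases w <;> norm_num [nodeOffset]
  rw [tNode_eq w (h1.trans h2), div_le_div_iff₀ (by positivity) hN]
  nlinarith [mul_pos Real.pi_pos hN]

theorem mul_pi_div_le_pi_sub_tNode (w : ChebKind) {n k : ℕ} (hk : k ∈ Finset.Icc 1 n) :
    (n + 1 - k : ℝ) * π / (2 * nw w n) ≤ π - tNode w n k := by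
  obtain ⟨h1, h2⟩ := Finset.mem_Icc.mp hk
  have hN := nw_pos w (h1.trans h2)
  have hk1 : (k : ℝ) ≤ n := by exact_mod_cast h2
  have hσ : (n : ℝ) + 1 / 2 ≤ nw w n + nodeOffset w := by
    cases w <;> norm_num [nodeOffset, nw] <;> linarith
  rw [tNode_eq w (h1.trans h2), div_le_iff₀ (by positivity)]
  have : (π - (k - nodeOffset w) * π / nw w n) * (2 * nw w n) =
      2 * (nw w n - k + nodeOffset w) * π := by field_simp; ring
  rw [this]
  have := Real.pi_pos
  gcongr
  linarith

theorem tNode_mem_Ioo (w : ChebKind) {n k : ℕ} (hk : k ∈ Finset.Icc 1 n) :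
    0 < tNode w n k ∧ tNode w n k < π := by
  obtain ⟨h1, h2⟩ := Finset.mem_Icc.mp hk
  have hN := nw_pos w (h1.trans h2)
  have hk1 : (k : ℝ) ≤ n := by exact_mod_cast h2
  have hπ := Real.pi_pos
  have hk0 : (0 : ℝ) < k := by exact_mod_cast h1
  have ha : 0 < (k : ℝ) * π / (2 * nw w n) := by positivity
  have hb : 0 < (n + 1 - k : ℝ) * π / (2 * nw w n) := by
    have : (0 : ℝ) < n + 1 - k := by linarith
    positivity
  exact ⟨ha.trans_le (mul_pi_div_le_tNode w hk),
    by linarith [mul_pi_div_le_pi_sub_tNode w hk]⟩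

theorem trigFn_nw_mul_tNode (w : ChebKind) {n : ℕ} (hn : 0 < n) (k : ℕ) :
    trigFn w (nw w n * tNode w n k) = 0 := by
  rw [tNode_eq w hn, mul_div_cancel₀ _ (nw_pos w hn).ne']
  have hc : Real.cos ((k - 1 / 2) * π) = 0 := by
    rw [Real.cos_eq_zero_iff]; exact ⟨k - 1, by push_cast; ring⟩
  cases w <;> simp only [trigFn, nodeOffset, hc, sub_zero, Real.sin_nat_mul_pi]

/-- The residual of the node sums of cosines. -/
noncomputable def nodeResidual : ChebKind → ℝ → ℝ
  | .one, _ => 0 | .two, x => -(1 + Real.cos (x * π)) / 2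
  | .three, x => -Real.cos (x * π) / 2 | .four, _ => -1 / 2

theorem two_mul_sin_mul_sum_cos (σ h : ℝ) (n : ℕ) :
    2 * Real.sin h * ∑ k ∈ Finset.Icc 1 n, Real.cos ((k - σ) * (2 * h)) =
      Real.sin ((2 * (n - σ) + 1) * h) - Real.sin ((1 - 2 * σ) * h) := by
  induction n with
  | zero => simp; ring_nf
  | succ n ih =>
    rw [Finset.sum_Icc_succ_top (by omega), mul_add, ih]
    have : 2 * Real.sin h * Real.cos (((n + 1 : ℕ) - σ) * (2 * h)) =
        Real.sin ((2 * ((n + 1 : ℕ) - σ) + 1) * h) - Real.sin ((2 * (n - σ) + 1) * h) := by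
      rw [show (2 * (((n + 1 : ℕ) : ℝ) - σ) + 1) * h = ((n + 1 : ℕ) - σ) * (2 * h) + h by ring,
        show (2 * ((n : ℝ) - σ) + 1) * h = ((n + 1 : ℕ) - σ) * (2 * h) - h by push_cast; ring,
        Real.sin_add, Real.sin_sub]
      ring
    linarith

theorem sum_cos_mul_tNode (w : ChebKind) {n : ℕ} (hn : 0 < n) {l : ℤ}
    (hl : |(l : ℝ)| < 2 * nw w n) :
    ∑ k ∈ Finset.Icc 1 n, Real.cos (l * tNode w n k) =
      nodeResidual w l + if l = 0 then nw w n else 0 := by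
  have hN := nw_pos w hn
  have hπ := Real.pi_pos
  split_ifs with h
  · subst h
    cases w <;> simp [nodeResidual, nw] <;> ring
  · set x : ℝ := l * π / (2 * nw w n) with hx
    have hxN : 2 * nw w n * x = l * π := by rw [hx]; field_simp
    have hs : Real.sin x ≠ 0 := by
      have hl0 : 0 < |(l : ℝ)| := by rw [abs_pos]; exact_mod_cast h
      have hax : |x| = |(l : ℝ)| * π / (2 * nw w n) := by
        rw [hx, abs_div, abs_mul, abs_of_pos hπ, abs_of_pos (by positivity : 0 < 2 * nw w n)]
      have h1 : 0 < |x| := by rw [hax]; positivity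
      have h2 : |x| < π := by
        rw [hax, div_lt_iff₀ (by positivity)]; nlinarith
      have := Real.sin_pos_of_pos_of_lt_pi h1 h2
      rcases abs_choice x with h3 | h3 <;> rw [h3] at this
      · exact this.ne'
      · rw [Real.sin_neg] at this; linarith
    have key := two_mul_sin_mul_sum_cos (nodeOffset w) x n
    have hterm : ∀ k : ℕ, (k - nodeOffset w) * (2 * x) = l * tNode w n k := fun k => by
      rw [tNode_eq w hn, hx]; field_simp
    simp only [hterm] at key
    have hsl : Real.sin (l * π) = 0 := Real.sin_int_mul_pi l
    refine mul_left_cancel₀ (mul_ne_zero two_ne_zero hs) (key.trans ?_)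
    cases w <;> simp only [nodeOffset, nodeResidual, nw] at hxN ⊢
    · rw [show (2 * ((n : ℝ) - 1 / 2) + 1) * x = l * π by linarith, hsl]
      norm_num
    · rw [show (2 * ((n : ℝ) - 0) + 1) * x = l * π - x by linarith, Real.sin_sub, hsl]
      norm_num; ring
    · rw [show (2 * ((n : ℝ) - 1 / 2) + 1) * x = l * π - x by linarith, Real.sin_sub, hsl]
      norm_num; ring
    · rw [show (2 * ((n : ℝ) - 0) + 1) * x = l * π by linarith, hsl]
      norm_num; ring

theorem nodeResidual_sub_add (w : ChebKind) (i j : ℕ) :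
    nodeResidual w (i - j) + trigSign w * nodeResidual w (i + j + freqShift w) = 0 := by
  have h1 : Real.cos (((i : ℝ) + j + 2) * π) = Real.cos ((i - j) * π) := by
    rw [show ((i : ℝ) + j + 2) * π = (i - j) * π + (j + 1 : ℕ) * (2 * π) by push_cast; ring,
      Real.cos_add_nat_mul_two_pi]
  have h2 : Real.cos (((i : ℝ) + j + 1) * π) = -Real.cos ((i - j) * π) := by
    rw [show ((i : ℝ) + j + 1) * π = (i - j) * π + j * (2 * π) + π by ring,
      Real.cos_add_pi, Real.cos_add_nat_mul_two_pi]
  cases w <;> simp only [nodeResidual, trigSign, freqShift, Nat.cast_one, Nat.cast_ofNat, h1, h2]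
    <;> ring

theorem sum_trigFn_mul_trigFn (w : ChebKind) {n i j : ℕ} (hij : i + j < 2 * n) :
    2 * ∑ k ∈ Finset.Icc 1 n, trigFn w ((i + (freqShift w : ℝ) / 2) * tNode w n k) *
        trigFn w ((j + (freqShift w : ℝ) / 2) * tNode w n k) =
      nw w n * ((if i = j then 1 else 0) +
        trigSign w * if i + j + freqShift w = 0 then 1 else 0) := by
  have hn : 0 < n := by omega
  have hij' : (i : ℝ) + j < 2 * n := by exact_mod_cast hij
  have e1 := sum_cos_mul_tNode w hn (l := (i : ℤ) - j) (by
    push_cast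
    have := le_nw w n
    have : (0 : ℝ) ≤ i := by positivity
    have : (0 : ℝ) ≤ j := by positivity
    rw [abs_lt]; constructor <;> linarith)
  have e2 := sum_cos_mul_tNode w hn (l := (i : ℤ) + j + freqShift w) (by
    push_cast
    rw [abs_of_nonneg (by positivity), nw_eq]; linarith)
  have e3 := nodeResidual_sub_add w i j
  push_cast at e1 e2
  have hterm : ∀ k : ℕ, 2 * (trigFn w ((i + (freqShift w : ℝ) / 2) * tNode w n k) *
        trigFn w ((j + (freqShift w : ℝ) / 2) * tNode w n k)) =
      Real.cos ((i - j) * tNode w n k) +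
        trigSign w * Real.cos ((i + j + freqShift w) * tNode w n k) := fun k => by
    rw [two_mul_trigFn_mul]; ring_nf
  rw [Finset.mul_sum, Finset.sum_congr rfl fun k _ => hterm k, Finset.sum_add_distrib,
    ← Finset.mul_sum, e1, e2]
  have c1 : ((i : ℤ) - j = 0) = (i = j) := by rw [sub_eq_zero, Nat.cast_inj]
  have c2 : ((i : ℤ) + j + freqShift w = 0) = (i + j + freqShift w = 0) := by
    rw [eq_iff_iff]; omega
  simp only [c1, c2]
  split_ifs <;> linear_combination e3

/-- Discrete orthonormality at the zeros of `p_n`. -/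
theorem sum_lam_mul_pEval_mul_pEval (w : ChebKind) {n i j : ℕ} (hij : i + j < 2 * n) :
    ∑ k ∈ Finset.Icc 1 n, lam w n k * pEval w i (xNode w n k) * pEval w j (xNode w n k) =
      if i = j then 1 else 0 := by
  have hn : 0 < n := by omega
  have hN := nw_pos w hn
  have hterm : ∀ k ∈ Finset.Icc 1 n,
      lam w n k * pEval w i (xNode w n k) * pEval w j (xNode w n k) =
      lamCoeff w * π * (trigNorm w i * trigNorm w j) / (2 * nw w n) *
        (2 * (trigFn w ((i + (freqShift w : ℝ) / 2) * tNode w n k) *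
        trigFn w ((j + (freqShift w : ℝ) / 2) * tNode w n k))) := by
    intro k hk
    obtain ⟨h0, hπ⟩ := tNode_mem_Ioo w hk
    have h1 := pEval_cos_mul_trigDenom w i h0 hπ
    have h2 := pEval_cos_mul_trigDenom w j h0 hπ
    rw [lam_eq, xNode]
    calc _ = lamCoeff w * π / nw w n * (pEval w i (Real.cos (tNode w n k)) *
          trigDenom w (tNode w n k)) * (pEval w j (Real.cos (tNode w n k)) *
          trigDenom w (tNode w n k)) := by ring
      _ = _ := by rw [h1, h2]; field_simp
  rw [Finset.sum_congr rfl hterm, ← Finset.mul_sum, ← Finset.mul_sum, sum_trigFn_mul_trigFn w hij]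
  have hc := lamCoeff_mul_trigNorm_sq w i
  by_cases h : i = j
  · subst h
    have hsg : i + i + freqShift w = 0 ↔ i + freqShift w = 0 := by omega
    have hsg' : i + freqShift w = 0 → trigSign w = 1 := by cases w <;> simp [freqShift, trigSign]
    rw [← sq, hc]
    simp only [hsg]
    split_ifs with h
    · rw [hsg' h]; field_simp; norm_num
    · field_simp; norm_num
  · have : ¬ i + j + freqShift w = 0 := by omega
    rw [if_neg h, if_neg this]; simp

theorem degree_pPoly (w : ChebKind) (j : ℕ) : (pPoly w j).degree = j := by
  have h1 : (1 / Real.sqrt π) ≠ 0 := by positivity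
  have h2 : Real.sqrt (2 / π) ≠ 0 := by positivity
  have hlt : (Polynomial.Chebyshev.U ℝ ((j : ℤ) - 1)).degree <
      (Polynomial.Chebyshev.U ℝ (j : ℤ)).degree := by
    cases j with
    | zero => simp
    | succ j =>
      rw [show ((j + 1 : ℕ) : ℤ) - 1 = (j : ℕ) by push_cast; ring,
        Polynomial.Chebyshev.degree_U_natCast, Polynomial.Chebyshev.degree_U_natCast]
      exact_mod_cast Nat.lt_succ_self j
  cases w
  · cases j with
    | zero => simpa [pPoly] using Polynomial.degree_C h1
    | succ j =>
      rw [pPoly, Polynomial.degree_C_mul h2, Polynomial.Chebyshev.degree_T]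
      congr 1
  · rw [pPoly, Polynomial.degree_C_mul h2, Polynomial.Chebyshev.degree_U_natCast]
  · rw [pPoly, Polynomial.degree_C_mul h1, Polynomial.degree_sub_eq_left_of_degree_lt hlt,
      Polynomial.Chebyshev.degree_U_natCast]
  · rw [pPoly, Polynomial.degree_C_mul h1, Polynomial.degree_add_eq_left_of_degree_lt hlt,
      Polynomial.Chebyshev.degree_U_natCast]

theorem mem_span_pPoly (w : ChebKind) {d : ℕ} {P : Polynomial ℝ} (hP : P.natDegree ≤ d) :
    P ∈ Submodule.span ℝ (pPoly w '' Set.Iic d) := by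
  let S : Polynomial.Sequence ℝ := ⟨pPoly w, degree_pPoly w⟩
  have := S.span_degreeLE (m := d) fun i _ => by
    rw [isUnit_iff_ne_zero, Polynomial.leadingCoeff_ne_zero]; exact S.ne_zero i
  change P ∈ Submodule.span ℝ (S '' Set.Iic d)
  rw [this, Polynomial.mem_degreeLE]
  exact Polynomial.degree_le_of_natDegree_le hP

/-- `V_n^m` reproduces polynomials of degree at most `n - m`. -/
theorem VP_eval (w : ChebKind) {n m : ℕ} (hm : 0 < m) (hmn : m < n) {P : Polynomial ℝ}
    (hP : P.natDegree ≤ n - m) (x : ℝ) : VP w n m (fun y => P.eval y) x = P.eval x := by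
  have hmem := mem_span_pPoly w hP
  clear hP
  induction hmem using Submodule.span_induction with
  | mem P h =>
    obtain ⟨i, hi, rfl⟩ := h
    rw [Set.mem_Iic] at hi
    have horth : ∀ j ∈ Finset.range (n + m), mufilt n m j * pEval w j x *
        (∑ k ∈ Finset.Icc 1 n, lam w n k * pEval w i (xNode w n k) * pEval w j (xNode w n k)) =
        if i = j then pEval w i x else 0 := by
      intro j hj
      rw [Finset.mem_range] at hj
      rw [sum_lam_mul_pEval_mul_pEval w (by omega)]
      split_ifs with h
      · subst h; simp [mufilt, hi]
      · simp
    calc VP w n m (fun y => (pPoly w i).eval y) x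
        = ∑ j ∈ Finset.range (n + m), mufilt n m j * pEval w j x *
          (∑ k ∈ Finset.Icc 1 n,
            lam w n k * pEval w i (xNode w n k) * pEval w j (xNode w n k)) := by
          simp only [VP, Phi, Finset.mul_sum]
          rw [Finset.sum_comm]
          refine Finset.sum_congr rfl fun j _ => Finset.sum_congr rfl fun k _ => ?_
          simp only [pEval]; ring
      _ = pEval w i x := by
          rw [Finset.sum_congr rfl horth, Finset.sum_ite_eq, if_pos]
          rw [Finset.mem_range]; omega
  | zero => simp [VP]
  | add P Q _ _ hP hQ =>
    rw [Polynomial.eval_add, ← hP, ← hQ]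
    simp only [VP, Polynomial.eval_add, add_mul, Finset.sum_add_distrib]
  | smul a P _ hP =>
    rw [Polynomial.eval_smul, ← hP]
    simp only [VP, Polynomial.eval_smul, smul_eq_mul, Finset.mul_sum, mul_assoc]

/-- `V_n^m f` is a polynomial of degree at most `n + m - 1`. -/
theorem exists_eval_eq_VP (w : ChebKind) (n m : ℕ) (f : ℝ → ℝ) :
    ∃ Q : Polynomial ℝ, Q.natDegree ≤ n + m - 1 ∧ ∀ x, Q.eval x = VP w n m f x := by
  refine ⟨∑ k ∈ Finset.Icc 1 n, Polynomial.C (f (xNode w n k)) * (Polynomial.C (lam w n k) *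
    ∑ j ∈ Finset.range (n + m), Polynomial.C (mufilt n m j * pEval w j (xNode w n k)) *
      pPoly w j), ?_, fun x => ?_⟩
  · refine Polynomial.natDegree_sum_le_of_forall_le _ _ fun k _ => ?_
    refine (Polynomial.natDegree_C_mul_le _ _).trans ((Polynomial.natDegree_C_mul_le _ _).trans ?_)
    refine Polynomial.natDegree_sum_le_of_forall_le _ _ fun j hj => ?_
    refine (Polynomial.natDegree_C_mul_le _ _).trans ?_
    rw [Polynomial.natDegree_eq_of_degree_eq_some (degree_pPoly w j)]
    rw [Finset.mem_range] at hj; omega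
  · simp [VP, Phi, pEval, Polynomial.eval_finsetSum]

theorem two_sub_two_cos_mul_cos (x y : ℝ) :
    (2 - 2 * Real.cos x) * Real.cos (y * x) =
      2 * Real.cos (y * x) - Real.cos ((y + 1) * x) - Real.cos ((y - 1) * x) := by
  rw [add_mul, sub_mul y, one_mul, Real.cos_add, Real.cos_sub]; ring

theorem two_sub_two_cos_mul_sum_cos (x α : ℝ) (l : ℕ) :
    (2 - 2 * Real.cos x) * ∑ j ∈ Finset.range l, Real.cos ((j + α) * x) =
      Real.cos (α * x) - Real.cos ((α - 1) * x) + Real.cos ((l + α - 1) * x) -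
        Real.cos ((l + α) * x) := by
  induction l with
  | zero => simp
  | succ l ih =>
    rw [Finset.sum_range_succ, mul_add, ih, two_sub_two_cos_mul_cos]
    push_cast
    ring_nf

theorem two_sub_two_cos_mul_sum_mul_cos (x β : ℝ) (M : ℕ) :
    (2 - 2 * Real.cos x) * ∑ j ∈ Finset.range M, ((M : ℝ) - j) * Real.cos ((j + β) * x) =
      M * (Real.cos (β * x) - Real.cos ((β - 1) * x)) + Real.cos (β * x) -
        Real.cos ((M + β) * x) := by
  induction M with
  | zero => simp
  | succ M ih =>
    have h : ∑ j ∈ Finset.range (M + 1), (((M + 1 : ℕ) : ℝ) - j) * Real.cos ((j + β) * x) =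
        ∑ j ∈ Finset.range M, ((M : ℝ) - j) * Real.cos ((j + β) * x) +
          ∑ j ∈ Finset.range (M + 1), Real.cos ((j + β) * x) := by
      rw [Finset.sum_range_succ, Finset.sum_range_succ, ← add_assoc, ← Finset.sum_add_distrib]
      congr 1
      · refine Finset.sum_congr rfl fun j _ => ?_
        push_cast; ring
      · push_cast; ring
    rw [h, mul_add, ih, two_sub_two_cos_mul_sum_cos]
    push_cast
    ring_nf

theorem two_sub_two_cos_mul_sum_mufilt (x α : ℝ) {n m : ℕ} (hm : 0 < m) (hmn : m < n) :
    (2 - 2 * Real.cos x) *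
        ∑ j ∈ Finset.range (n + m), mufilt n m j * Real.cos ((j + α) * x) =
      (Real.cos ((n + α - m) * x) - Real.cos ((n + α + m) * x)) / (2 * m) +
        (Real.cos (α * x) - Real.cos ((α - 1) * x)) := by
  obtain ⟨l, rfl⟩ : ∃ l, n = l + m := ⟨n - m, by omega⟩
  have hm0 : (m : ℝ) ≠ 0 := by positivity
  have h1 : ∑ j ∈ Finset.range l, mufilt (l + m) m j * Real.cos ((j + α) * x) =
      ∑ j ∈ Finset.range l, Real.cos ((j + α) * x) := by
    refine Finset.sum_congr rfl fun j hj => ?_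
    rw [Finset.mem_range] at hj
    rw [mufilt, if_pos (by omega), one_mul]
  have h2 : ∑ j ∈ Finset.range (2 * m),
        mufilt (l + m) m (l + j) * Real.cos (((l + j : ℕ) + α) * x) =
      1 / (2 * m) * ∑ j ∈ Finset.range (2 * m),
        (((2 * m : ℕ) : ℝ) - j) * Real.cos ((j + (l + α)) * x) := by
    rw [Finset.mul_sum]
    refine Finset.sum_congr rfl fun j hj => ?_
    have : mufilt (l + m) m (l + j) = (((2 * m : ℕ) : ℝ) - j) / (2 * m) := by
      rw [mufilt]
      split_ifs with h
      · have : j = 0 := by omega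
        subst this; push_cast; field_simp; simp
      · push_cast; ring
    rw [this]; push_cast; ring_nf
  have h3 := two_sub_two_cos_mul_sum_cos x α l
  have h4 := two_sub_two_cos_mul_sum_mul_cos x (l + α) (2 * m)
  rw [show l + m + m = l + 2 * m by ring, Finset.sum_range_add, h1, h2, mul_add, h3,
    mul_left_comm, h4]
  push_cast
  rw [show (l + m + α - m : ℝ) = l + α by ring, show (l + m + α + m : ℝ) = 2 * m + (l + α) by ring]
  field_simp
  ring

/-- The de la Vallée Poussin kernel. -/
noncomputable def vpKernel (w : ChebKind) (n m : ℕ) (x : ℝ) : ℝ :=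
  ∑ j ∈ Finset.range (n + m), mufilt n m j * Real.cos ((j + (freqShift w : ℝ) / 2) * x) +
    ((freqShift w : ℝ) / 2 - 1 / 2)

theorem vpKernel_mul (w : ChebKind) {n m : ℕ} (hm : 0 < m) (hmn : m < n) (x : ℝ) :
    vpKernel w n m x * (4 * m * Real.sin (x / 2) ^ 2) =
      Real.sin (nw w n * x) * Real.sin (m * x) := by
  have hm0 : (m : ℝ) ≠ 0 := by positivity
  have h1 := two_sub_two_cos_mul_sum_mufilt x ((freqShift w : ℝ) / 2) hm hmn
  have h2 : Real.sin (x / 2) ^ 2 = (2 - 2 * Real.cos x) / 4 := by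
    rw [Real.sin_sq_eq_half_sub, mul_div_cancel₀ x two_ne_zero]; ring
  have h3 : Real.cos ((freqShift w : ℝ) / 2 * x) - Real.cos (((freqShift w : ℝ) / 2 - 1) * x) =
      (1 / 2 - (freqShift w : ℝ) / 2) * (2 - 2 * Real.cos x) := by
    cases w <;> simp only [freqShift]
    · norm_num; ring
    · norm_num; ring
    all_goals
      rw [show (((1 : ℕ) : ℝ) / 2 - 1) * x = -(((1 : ℕ) : ℝ) / 2 * x) by push_cast; ring,
        Real.cos_neg]
      norm_num
  rw [h3, ← nw_eq, sub_mul (nw w n), add_mul (nw w n), Real.cos_sub, Real.cos_add] at h1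
  rw [h2, vpKernel]
  generalize ∑ j ∈ Finset.range (n + m),
    mufilt n m j * Real.cos ((j + (freqShift w : ℝ) / 2) * x) = A at h1 ⊢
  field_simp at h1 ⊢
  linear_combination h1 / 2

theorem abs_sin_nw_mul_sub_le (w : ChebKind) {N s : ℝ} (hs : trigFn w (N * s) = 0) (t : ℝ) :
    |Real.sin (N * (t - s))| ≤ |trigFn w (N * t)| ∧
      |Real.sin (N * (t + s))| ≤ |trigFn w (N * t)| := by
  have h1 := Real.abs_sin_le_one (N * s)
  have h2 := Real.abs_cos_le_one (N * s)
  rw [mul_sub, mul_add, Real.sin_sub, Real.sin_add]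
  cases w <;> simp only [trigFn] at hs ⊢ <;> simp only [hs, mul_zero, zero_sub, sub_zero, zero_add,
    add_zero, abs_neg, abs_mul] <;> exact
    ⟨mul_le_of_le_one_right (abs_nonneg _) (by assumption),
     mul_le_of_le_one_right (abs_nonneg _) (by assumption)⟩

/-- The trigonometric form of the fundamental polynomials. -/
noncomputable def trigPhi (w : ChebKind) (n m : ℕ) (s t : ℝ) : ℝ :=
  ∑ j ∈ Finset.range (n + m), mufilt n m j * (2 - if j + freqShift w = 0 then 1 else 0) *
    (trigFn w ((j + (freqShift w : ℝ) / 2) * s) * trigFn w ((j + (freqShift w : ℝ) / 2) * t))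

theorem Phi_cos_mul_trigDenom (w : ChebKind) {n k : ℕ} (m : ℕ) (hk : k ∈ Finset.Icc 1 n) {t : ℝ}
    (h0 : 0 < t) (hπ : t < π) :
    Phi w n m k (Real.cos t) * trigDenom w t =
      trigDenom w (tNode w n k) / nw w n * trigPhi w n m (tNode w n k) t := by
  obtain ⟨hs0, hsπ⟩ := tNode_mem_Ioo w hk
  rw [Phi, trigPhi, lam_eq, mul_assoc, Finset.sum_mul, Finset.mul_sum, Finset.mul_sum]
  refine Finset.sum_congr rfl fun j _ => ?_
  have h1 := pEval_cos_mul_trigDenom w j h0 hπ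
  have h2 := pEval_cos_mul_trigDenom w j hs0 hsπ
  rw [← lamCoeff_mul_trigNorm_sq w j, xNode]
  calc _ = lamCoeff w * π / nw w n * mufilt n m j * trigDenom w (tNode w n k) *
        (pEval w j (Real.cos (tNode w n k)) * trigDenom w (tNode w n k)) *
        (pEval w j (Real.cos t) * trigDenom w t) := by ring
    _ = _ := by rw [h1, h2]; ring

theorem trigPhi_eq (w : ChebKind) {n m : ℕ} (hmn : m < n) (s t : ℝ) :
    trigPhi w n m s t = vpKernel w n m (t - s) + trigSign w * vpKernel w n m (t + s) := by
  have hterm : ∀ j : ℕ, mufilt n m j * (2 - if j + freqShift w = 0 then 1 else 0) *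
      (trigFn w ((j + (freqShift w : ℝ) / 2) * s) *
        trigFn w ((j + (freqShift w : ℝ) / 2) * t)) =
      (mufilt n m j * Real.cos ((j + (freqShift w : ℝ) / 2) * (t - s)) +
        trigSign w * (mufilt n m j * Real.cos ((j + (freqShift w : ℝ) / 2) * (t + s)))) -
      if j = 0 then (if freqShift w = 0 then 1 else 0) else 0 := by
    intro j
    have h1 := two_mul_trigFn_mul w ((j + (freqShift w : ℝ) / 2) * t)
      ((j + (freqShift w : ℝ) / 2) * s)
    rw [← mul_sub, ← mul_add] at h1
    by_cases hj : j = 0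
    · subst hj
      by_cases hf : freqShift w = 0
      · have hw : trigFn w 0 = 1 := by cases w <;> simp_all [freqShift, trigFn]
        have hsg : trigSign w = 1 := by cases w <;> simp_all [freqShift, trigSign]
        simp [hf, hw, hsg, mufilt]; norm_num
      · simp only [zero_add, hf, if_true, if_false, sub_zero]
        rw [mul_assoc, mul_left_comm (trigSign w), ← mul_add]
        congr 1
        simp only [Nat.cast_zero, zero_add] at h1 ⊢
        rw [← h1]; ring
    · have : ¬ j + freqShift w = 0 := by omega
      simp only [hj, this, if_false, sub_zero]
      rw [mul_assoc, mul_left_comm (trigSign w), ← mul_add, ← h1]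
      ring
  have hconst : (if freqShift w = 0 then 1 else 0 : ℝ) +
      ((freqShift w : ℝ) / 2 - 1 / 2) * (1 + trigSign w) = 0 := by
    cases w <;> norm_num [freqShift, trigSign]
  rw [trigPhi, Finset.sum_congr rfl fun j _ => hterm j, Finset.sum_sub_distrib,
    Finset.sum_add_distrib, ← Finset.mul_sum, Finset.sum_ite_eq',
    if_pos (Finset.mem_range.mpr (by omega)), vpKernel, vpKernel]
  linear_combination -hconst

theorem abs_trigPhi_mul_sin_sq_le (w : ChebKind) {n m : ℕ} (hm : 0 < m) (hmn : m < n) {s t : ℝ}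
    (hs0 : 0 ≤ s) (hsπ : s ≤ π) (ht0 : 0 ≤ t) (htπ : t ≤ π) (hs : trigFn w (nw w n * s) = 0) :
    |trigPhi w n m s t| * Real.sin ((t - s) / 2) ^ 2 ≤ |trigFn w (nw w n * t)| / (2 * m) := by
  obtain ⟨h1, h2⟩ := abs_sin_nw_mul_sub_le w hs t
  have hm0 : (0 : ℝ) < m := by positivity
  have hker : ∀ x, |Real.sin (nw w n * x)| ≤ |trigFn w (nw w n * t)| →
      |vpKernel w n m x| * Real.sin (x / 2) ^ 2 ≤ |trigFn w (nw w n * t)| / (4 * m) := by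
    intro x hx
    have h3 := congrArg abs (vpKernel_mul w hm hmn x)
    rw [abs_mul (vpKernel w n m x), abs_mul (Real.sin (nw w n * x)), abs_of_nonneg (by positivity : 0 ≤ 4 * m * Real.sin (x / 2) ^ 2)] at h3
    rw [le_div_iff₀ (by positivity)]
    have h4 := mul_le_mul hx (Real.abs_sin_le_one (m * x)) (abs_nonneg _) (abs_nonneg _)
    linarith
  have hsin : Real.sin ((t - s) / 2) ^ 2 ≤ Real.sin ((t + s) / 2) ^ 2 := by
    have : Real.sin ((t + s) / 2) ^ 2 - Real.sin ((t - s) / 2) ^ 2 = Real.sin t * Real.sin s := by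
      rw [Real.sin_sq_eq_half_sub, Real.sin_sq_eq_half_sub, mul_div_cancel₀ _ two_ne_zero,
        mul_div_cancel₀ _ two_ne_zero, Real.cos_sub, Real.cos_add]
      ring
    have := mul_nonneg (Real.sin_nonneg_of_nonneg_of_le_pi ht0 htπ)
      (Real.sin_nonneg_of_nonneg_of_le_pi hs0 hsπ)
    linarith
  have hsg : |trigSign w| = 1 := by cases w <;> simp [trigSign]
  have e1 := hker _ h1
  have e2 := (mul_le_mul_of_nonneg_left hsin (abs_nonneg (vpKernel w n m (t + s)))).trans
    (hker _ h2)
  have e3 := abs_add_le (vpKernel w n m (t - s)) (trigSign w * vpKernel w n m (t + s))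
  rw [← trigPhi_eq w hmn, abs_mul, hsg, one_mul] at e3
  have e4 := mul_le_mul_of_nonneg_right e3 (sq_nonneg (Real.sin ((t - s) / 2)))
  have e5 : |trigFn w (nw w n * t)| / (2 * m) = |trigFn w (nw w n * t)| / (4 * m) +
    |trigFn w (nw w n * t)| / (4 * m) := by field_simp; ring
  linarith

theorem abs_trigPhi_le (w : ChebKind) {n m : ℕ} (hm : 0 < m) (hmn : m < n) (s t : ℝ) :
    |trigPhi w n m s t| ≤ 2 * (n + m) := by
  have hm0 : (0 : ℝ) < m := by positivity
  refine (Finset.abs_sum_le_sum_abs _ _).trans ?_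
  have hterm : ∀ j ∈ Finset.range (n + m),
      |mufilt n m j * (2 - if j + freqShift w = 0 then 1 else 0) *
      (trigFn w ((j + (freqShift w : ℝ) / 2) * s) *
        trigFn w ((j + (freqShift w : ℝ) / 2) * t))| ≤ 2 := by
    intro j hj
    rw [Finset.mem_range] at hj
    have hμ : |mufilt n m j| ≤ 1 := by
      rw [mufilt]
      split_ifs with h
      · simp
      · have h1 : (j : ℝ) ≤ n + m := by exact_mod_cast hj.le
        have h2 : (n : ℝ) ≤ j + m := by exact_mod_cast (by omega : n ≤ j + m)
        rw [abs_of_nonneg (div_nonneg (by linarith) (by positivity)), div_le_one (by positivity)]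
        linarith
    have he : |(2 : ℝ) - if j + freqShift w = 0 then 1 else 0| ≤ 2 := by
      split_ifs <;> norm_num
    have ht := mul_le_mul (abs_trigFn_le_one w ((j + (freqShift w : ℝ) / 2) * s))
      (abs_trigFn_le_one w ((j + (freqShift w : ℝ) / 2) * t)) (abs_nonneg _) zero_le_one
    rw [abs_mul, abs_mul, abs_mul]
    have := mul_le_mul (mul_le_mul hμ he (abs_nonneg _) zero_le_one) ht (by positivity)
      (by norm_num)
    linarith
  refine (Finset.sum_le_card_nsmul _ _ _ hterm).trans ?_
  simp; linarith

theorem abs_sin_natCast_mul_le (k : ℕ) (x : ℝ) : |Real.sin (k * x)| ≤ k * |Real.sin x| := by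
  induction k with
  | zero => simp
  | succ k ih =>
    have h1 := Real.abs_cos_le_one x
    have h2 := Real.abs_cos_le_one (k * x)
    push_cast
    rw [add_mul, add_mul, one_mul, one_mul, Real.sin_add]
    refine (abs_add_le _ _).trans (add_le_add ?_ ?_)
    · rw [abs_mul]; exact (mul_le_of_le_one_right (abs_nonneg _) h1).trans ih
    · rw [abs_mul]; exact mul_le_of_le_one_left (abs_nonneg _) h2

/-- The exponent of `sin (t / 2)` in `trigDenom w t`. -/
def sinExp : ChebKind → ℝ
  | .one => 0 | .two => 1 | .three => 0 | .four => 1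

/-- The exponent of `cos (t / 2)` in `trigDenom w t`. -/
def cosExp : ChebKind → ℝ
  | .one => 0 | .two => 1 | .three => 1 | .four => 0

theorem abs_trigFn_nw_mul_le_sin (w : ChebKind) (hw : sinExp w ≠ 0) (n : ℕ) (t : ℝ) :
    |trigFn w (nw w n * t)| ≤ 2 * nw w n * |Real.sin (t / 2)| := by
  have h := abs_sin_natCast_mul_le (2 * n + freqShift w) (t / 2)
  have e : ((2 * n + freqShift w : ℕ) : ℝ) = 2 * nw w n := by rw [nw_eq]; push_cast; ring
  rw [e, mul_assoc, mul_left_comm, mul_div_cancel₀ _ two_ne_zero] at h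
  cases w <;> simp_all [sinExp, trigFn]

theorem abs_trigFn_nw_mul_le_cos (w : ChebKind) (hw : cosExp w ≠ 0) (n : ℕ) (t : ℝ) :
    |trigFn w (nw w n * t)| ≤ 2 * nw w n * |Real.cos (t / 2)| := by
  have h := abs_sin_natCast_mul_le (2 * n + freqShift w) (π / 2 - t / 2)
  have e : ((2 * n + freqShift w : ℕ) : ℝ) = 2 * nw w n := by rw [nw_eq]; push_cast; ring
  rw [Real.sin_pi_div_two_sub, e] at h
  refine le_of_eq_of_le ?_ h
  cases w <;> simp only [cosExp, ne_eq, not_true_eq_false] at hw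
  · have : 2 * nw .two n * (π / 2 - t / 2) = ((n + 1 : ℕ) : ℝ) * π - nw .two n * t := by
      simp only [nw]; push_cast; ring
    rw [this, Real.sin_nat_mul_pi_sub, abs_neg, abs_mul, abs_pow, abs_neg, abs_one, one_pow,
      one_mul, trigFn]
  · have : 2 * nw .three n * (π / 2 - t / 2) = π / 2 - nw .three n * t + n * π := by
      simp only [nw]; ring
    rw [this, Real.sin_add_nat_mul_pi, abs_mul, abs_pow, abs_neg, abs_one, one_pow,
      one_mul, Real.sin_pi_div_two_sub, trigFn]

theorem exists_jac_cos_eq (w : ChebKind) (γ δ : ℝ) : ∃ K : ℝ, 0 < K ∧ ∀ t, 0 < t → t < π →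
    jac γ δ (Real.cos t) = K * (Real.sin (t / 2) ^ (2 * γ - sinExp w) *
      Real.cos (t / 2) ^ (2 * δ - cosExp w)) * trigDenom w t := by
  refine ⟨2 ^ γ * 2 ^ δ * (1 - sinExp w * cosExp w / 2), ?_, ?_⟩
  · refine mul_pos (by positivity) ?_
    cases w <;> norm_num [sinExp, cosExp]
  intro t h0 hπ
  have hs : 0 < Real.sin (t / 2) := Real.sin_pos_of_pos_of_lt_pi (by linarith) (by linarith)
  have hc : 0 < Real.cos (t / 2) := Real.cos_pos_of_mem_Ioo ⟨by linarith, by linarith⟩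
  have h1 : 1 - Real.cos t = 2 * Real.sin (t / 2) ^ (2 : ℝ) := by
    rw [Real.rpow_two, Real.sin_sq_eq_half_sub, mul_div_cancel₀ t two_ne_zero]; ring
  have h2 : 1 + Real.cos t = 2 * Real.cos (t / 2) ^ (2 : ℝ) := by
    rw [Real.rpow_two, Real.cos_sq, mul_div_cancel₀ t two_ne_zero]; ring
  have hd : Real.sin t = 2 * Real.sin (t / 2) * Real.cos (t / 2) := by
    rw [← Real.sin_two_mul, mul_div_cancel₀ t two_ne_zero]
  rw [jac, h1, h2, Real.mul_rpow two_pos.le (by positivity), Real.mul_rpow two_pos.le (by positivity),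
    ← Real.rpow_mul hs.le, ← Real.rpow_mul hc.le, Real.rpow_sub hs, Real.rpow_sub hc]
  cases w <;> norm_num [sinExp, cosExp, trigDenom, hd] <;> field_simp

theorem jac_pos (γ δ : ℝ) {x : ℝ} (h1 : -1 < x) (h2 : x < 1) : 0 < jac γ δ x :=
  mul_pos (Real.rpow_pos_of_pos (by linarith) _) (Real.rpow_pos_of_pos (by linarith) _)

theorem cos_mem_Ioo {t : ℝ} (h0 : 0 < t) (hπ : t < π) : -1 < Real.cos t ∧ Real.cos t < 1 := by
  constructor
  · rw [← Real.cos_pi]; exact Real.cos_lt_cos_of_nonneg_of_le_pi h0.le le_rfl hπ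
  · rw [← Real.cos_zero]; exact Real.cos_lt_cos_of_nonneg_of_le_pi le_rfl hπ.le h0

/-- The weighted Lebesgue constants of the operators `V_n^m` are uniformly bounded. -/
theorem exists_sum_abs_Phi_mul_le (w : ChebKind) {γ δ : ℝ} (hu : hpu w γ δ) {c : ℝ} (hc : 1 < c) :
    ∃ C : ℝ, 0 < C ∧ ∀ n m : ℕ, 0 < m → m < n → (n : ℝ) ≤ c * m → ∀ x, -1 < x → x < 1 →
      ∑ k ∈ Finset.Icc 1 n, |Phi w n m k x| * (jac γ δ x / jac γ δ (xNode w n k)) ≤ C := by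
  obtain ⟨hp1, hq1, hp2, hq2, hpq, hqp, hpw, hqw⟩ :
      -1 < 2 * γ - sinExp w ∧ -1 < 2 * δ - cosExp w ∧ 2 * γ - sinExp w ≤ 2 ∧
      2 * δ - cosExp w ≤ 2 ∧ (2 * γ - sinExp w) - (2 * δ - cosExp w) ≤ 2 ∧
      (2 * δ - cosExp w) - (2 * γ - sinExp w) ≤ 2 ∧
      (2 * γ - sinExp w < 0 → sinExp w ≠ 0) ∧ (2 * δ - cosExp w < 0 → cosExp w ≠ 0) := by
    cases w <;> simp only [hpu, sinExp, cosExp] at hu ⊢ <;> refine ⟨?_, ?_, ?_, ?_, ?_, ?_, ?_, ?_⟩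
      <;> first
        | linarith
        | (intro h; exact one_ne_zero)
        | (intro h; exfalso; linarith)
  obtain ⟨C, hC, hbound⟩ := exists_weighted_kernel_sum_le hp1 hq1 hp2 hq2 hpq hqp
  obtain ⟨K, hK, hjac⟩ := exists_jac_cos_eq w γ δ
  refine ⟨4 * c * C, by positivity, ?_⟩
  intro n m hm hmn hnm x hx1 hx2
  obtain ⟨t, ht0, htπ, rfl⟩ : ∃ t, 0 < t ∧ t < π ∧ Real.cos t = x :=
    ⟨Real.arccos x, Real.arccos_pos.mpr hx2,
      (Real.arccos_le_pi x).lt_of_ne fun h => hx1.not_ge (Real.arccos_eq_pi.mp h),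
      Real.cos_arccos hx1.le hx2.le⟩
  have hn : 0 < n := hm.trans hmn
  have hN := nw_pos w hn
  have hm1 : (1 : ℝ) ≤ m := by exact_mod_cast hm
  have hmn' : (m : ℝ) ≤ n := by exact_mod_cast hmn.le
  have hnN := le_nw w n
  have hNn := nw_le w n
  have hsin : 0 < Real.sin (t / 2) := Real.sin_pos_of_pos_of_lt_pi (by linarith) (by linarith)
  have hcos : 0 < Real.cos (t / 2) := Real.cos_pos_of_mem_Ioo ⟨by linarith, by linarith⟩
  have hsum := hbound n (nw w n) (nodeOffset w) t |trigFn w (nw w n * t)|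
    (fun k => |trigPhi w n m (tNode w n k) t| / (4 * c * nw w n)) (tNode w n) hN ht0 htπ
    (tNode_eq w hn) (fun k hk => mul_pi_div_le_tNode w hk)
    (fun k hk => mul_pi_div_le_pi_sub_tNode w hk) ?_
    (by cases w <;> norm_num [nodeOffset, abs_of_pos]) (abs_nonneg _) (abs_trigFn_le_one w _)
    (fun h => by
      have := abs_trigFn_nw_mul_le_sin w (hpw h) n t
      rwa [abs_of_pos hsin] at this)
    (fun h => by
      have := abs_trigFn_nw_mul_le_cos w (hqw h) n t
      rwa [abs_of_pos hcos] at this)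
  · refine le_trans (le_of_eq ?_) (mul_le_mul_of_nonneg_left hsum (by positivity : 0 ≤ 4 * c))
    rw [Finset.mul_sum]
    refine Finset.sum_congr rfl fun k hk => ?_
    obtain ⟨hs0, hsπ⟩ := tNode_mem_Ioo w hk
    have hssin : 0 < Real.sin (tNode w n k / 2) :=
      Real.sin_pos_of_pos_of_lt_pi (by linarith) (by linarith)
    have hscos : 0 < Real.cos (tNode w n k / 2) :=
      Real.cos_pos_of_mem_Ioo ⟨by linarith, by linarith⟩
    have hdt := trigDenom_pos w ht0 htπ
    have hds := trigDenom_pos w hs0 hsπ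
    have hΦ : |Phi w n m k (Real.cos t)| = trigDenom w (tNode w n k) / nw w n *
        |trigPhi w n m (tNode w n k) t| / trigDenom w t := by
      have h := congrArg abs (Phi_cos_mul_trigDenom w m hk ht0 htπ)
      rw [abs_mul, abs_mul, abs_of_pos hdt, abs_of_pos (div_pos hds hN)] at h
      rw [eq_div_iff hdt.ne', h]
    rw [hΦ, xNode, hjac t ht0 htπ, hjac _ hs0 hsπ, Real.div_rpow hsin.le hssin.le,
      Real.div_rpow hcos.le hscos.le]
    have := Real.rpow_pos_of_pos hssin (2 * γ - sinExp w)
    have := Real.rpow_pos_of_pos hscos (2 * δ - cosExp w)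
    field_simp
  · intro k hk
    obtain ⟨hs0, hsπ⟩ := tNode_mem_Ioo w hk
    refine ⟨by positivity, ?_, ?_⟩
    · rw [div_le_one (by positivity)]
      refine (abs_trigPhi_le w hm hmn _ _).trans ?_
      nlinarith
    · have h := abs_trigPhi_mul_sin_sq_le w hm hmn hs0.le hsπ.le ht0.le htπ.le
        (trigFn_nw_mul_tNode w hn k)
      have hS := abs_nonneg (trigFn w (nw w n * t))
      rw [le_div_iff₀ (by positivity)] at h
      rw [mul_pow, sq_abs, div_mul_eq_mul_div, div_le_iff₀ (by positivity)]
      have hb : nw w n ≤ 2 * c * m := by linarith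
      have h3 := mul_le_mul_of_nonneg_left h (sq_nonneg (nw w n))
      have h4 : |trigFn w (nw w n * t)| * nw w n * nw w n ≤
          |trigFn w (nw w n * t)| * nw w n * (2 * c * m) := by gcongr
      have h5 : 0 ≤ |trigFn w (nw w n * t)| * nw w n * (2 * c * m) := by positivity
      refine le_of_mul_le_mul_right (a := 2 * (m : ℝ)) ?_ (by positivity)
      linarith

theorem continuous_jac {γ δ : ℝ} (hγ : 0 ≤ γ) (hδ : 0 ≤ δ) : Continuous (jac γ δ) :=
  ((continuous_const.sub continuous_id).rpow_const fun _ => Or.inr hγ).mul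
    ((continuous_const.add continuous_id).rpow_const fun _ => Or.inr hδ)

theorem abs_mul_jac_le_wnorm {γ δ : ℝ} {g : ℝ → ℝ}
    (hg : ContinuousOn (fun x => g x * jac γ δ x) (Set.Icc (-1) 1)) {x : ℝ}
    (hx : x ∈ Set.Icc (-1 : ℝ) 1) : |g x * jac γ δ x| ≤ wnorm γ δ g :=
  le_csSup (isCompact_Icc.bddAbove_image hg.abs) ⟨x, hx, rfl⟩

theorem wnorm_nonneg (γ δ : ℝ) (g : ℝ → ℝ) : 0 ≤ wnorm γ δ g := by
  refine Real.sSup_nonneg ?_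
  rintro _ ⟨x, -, rfl⟩
  exact abs_nonneg _

theorem wnorm_le {γ δ B : ℝ} {g : ℝ → ℝ}
    (hg : ContinuousOn (fun x => g x * jac γ δ x) (Set.Icc (-1) 1))
    (h : ∀ x, -1 < x → x < 1 → |g x * jac γ δ x| ≤ B) : wnorm γ δ g ≤ B := by
  have hcl : closure (Set.Ioo (-1 : ℝ) 1) = Set.Icc (-1) 1 := closure_Ioo (by norm_num)
  refine csSup_le ⟨_, 0, by norm_num, rfl⟩ ?_
  rintro _ ⟨x, hx, rfl⟩
  rw [← hcl] at hx hg
  exact le_on_closure (fun y hy => h y hy.1 hy.2) hg.abs continuousOn_const hx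

theorem bestE_le_wnorm {γ δ : ℝ} {d : ℕ} {P : Polynomial ℝ} (hP : P.natDegree ≤ d) (f : ℝ → ℝ) :
    bestE γ δ d f ≤ wnorm γ δ (fun x => f x - P.eval x) := by
  refine csInf_le ⟨0, ?_⟩ ⟨P, hP, rfl⟩
  rintro _ ⟨Q, -, rfl⟩
  exact wnorm_nonneg _ _ _

theorem xNode_mem_Ioo (w : ChebKind) {n k : ℕ} (hk : k ∈ Finset.Icc 1 n) :
    -1 < xNode w n k ∧ xNode w n k < 1 :=
  cos_mem_Ioo (tNode_mem_Ioo w hk).1 (tNode_mem_Ioo w hk).2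

theorem abs_VP_mul_jac_le (w : ChebKind) {γ δ : ℝ} {n m : ℕ} {g : ℝ → ℝ}
    (hg : ContinuousOn (fun x => g x * jac γ δ x) (Set.Icc (-1) 1)) {x : ℝ}
    (hx1 : -1 < x) (hx2 : x < 1) :
    |VP w n m g x * jac γ δ x| ≤ (∑ k ∈ Finset.Icc 1 n,
      |Phi w n m k x| * (jac γ δ x / jac γ δ (xNode w n k))) * wnorm γ δ g := by
  have hj := jac_pos γ δ hx1 hx2
  rw [abs_mul, abs_of_pos hj, VP, Finset.sum_mul]
  refine (mul_le_mul_of_nonneg_right (Finset.abs_sum_le_sum_abs _ _) hj.le).trans ?_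
  rw [Finset.sum_mul]
  refine Finset.sum_le_sum fun k hk => ?_
  obtain ⟨h1, h2⟩ := xNode_mem_Ioo w hk
  have hjk := jac_pos γ δ h1 h2
  have h := abs_mul_jac_le_wnorm hg ⟨h1.le, h2.le⟩
  rw [abs_mul, abs_of_pos hjk] at h
  calc |g (xNode w n k) * Phi w n m k x| * jac γ δ x
      = |Phi w n m k x| * (jac γ δ x / jac γ δ (xNode w n k)) *
        (|g (xNode w n k)| * jac γ δ (xNode w n k)) := by rw [abs_mul]; field_simp
    _ ≤ _ := by gcongr

/-- near-best approximation of the VP interpolation operator in `C^0_u`. -/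
theorem stmt0 (w : ChebKind) (γ δ : ℝ) (hu : hpu w γ δ) :
    ∀ c1 : ℝ, 1 < c1 → ∃ C : ℝ, 0 < C ∧
      ∀ n m : ℕ, 0 < m → m < n → (n : ℝ) ≤ c1 * m →
        ∀ f : ℝ → ℝ, MemC0 γ δ f →
          bestE γ δ (n + m - 1) f ≤ wnorm γ δ (fun x => VP w n m f x - f x) ∧
          wnorm γ δ (fun x => VP w n m f x - f x) ≤ C * bestE γ δ (n - m) f := by
  intro c1 hc1
  obtain ⟨C, hC, hLeb⟩ := exists_sum_abs_Phi_mul_le w hu hc1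
  have hγδ : 0 ≤ γ ∧ 0 ≤ δ := by
    cases w <;> simp only [hpu] at hu <;> exact ⟨by linarith, by linarith⟩
  have hjac := continuous_jac hγδ.1 hγδ.2
  refine ⟨C + 1, by positivity, ?_⟩
  intro n m hm hmn hnm f hf
  have hpoly : ∀ P : Polynomial ℝ,
      ContinuousOn (fun x => P.eval x * jac γ δ x) (Set.Icc (-1) 1) := fun P =>
    (P.continuous.mul hjac).continuousOn
  have hsub : ∀ P : Polynomial ℝ,
      ContinuousOn (fun x => (f x - P.eval x) * jac γ δ x) (Set.Icc (-1) 1) := fun P => by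
    simp only [sub_mul]
    exact hf.2.1.sub (hpoly P)
  obtain ⟨Q, hQdeg, hQ⟩ := exists_eval_eq_VP w n m f
  have hVP : wnorm γ δ (fun x => VP w n m f x - f x) =
      wnorm γ δ (fun x => f x - Q.eval x) := by
    simp only [wnorm, hQ]
    congr 2
    ext x
    rw [abs_mul, abs_mul, abs_sub_comm]
  refine ⟨hVP ▸ bestE_le_wnorm hQdeg f, ?_⟩
  rw [mul_comm, ← div_le_iff₀ (by positivity)]
  refine le_csInf ⟨_, 0, by simp, rfl⟩ ?_
  rintro _ ⟨P, hP, rfl⟩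
  rw [div_le_iff₀ (by positivity), hVP]
  refine wnorm_le (hsub Q) fun x hx1 hx2 => ?_
  have hx : x ∈ Set.Icc (-1 : ℝ) 1 := ⟨hx1.le, hx2.le⟩
  have hlin : VP w n m (fun y => f y - P.eval y) x = VP w n m f x - P.eval x := by
    rw [← VP_eval w hm hmn hP x]
    simp only [VP, sub_mul, Finset.sum_sub_distrib]
  have h1 := abs_mul_jac_le_wnorm (hsub P) hx
  have h2 := (abs_VP_mul_jac_le w (n := n) (m := m) (hsub P) hx1 hx2).trans
    (mul_le_mul_of_nonneg_right (hLeb n m hm hmn hnm x hx1 hx2) (wnorm_nonneg _ _ _))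
  rw [hQ]
  calc |(f x - VP w n m f x) * jac γ δ x|
      = |(f x - P.eval x) * jac γ δ x -
          VP w n m (fun y => f y - P.eval y) x * jac γ δ x| := by rw [hlin]; ring_nf
    _ ≤ _ := abs_sub _ _
    _ ≤ _ := by linarith
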